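/- arXiv:1903.01002 — 2 statements merged into one kernel-verified Lean document; each statement's English description precedes it below -/
import Mathlib

section
/- Let 2 ≤ r < k and n be positive integers. For every red-blue graph G on n vertices such that G contains no copy of K_k and the red subgraph G_red contains no copy of K_r, we have |E(G_red)| + N(K_r, G_blue) ≤ max{ e(T(n, r−1)), N(K_r, T(n, k−1)) }, where T(n, s) is the Turán graph, i.e., the complete s-partite graph on n vertices with parts of sizes as equal as possible, and e(T(n,s)) is its number of edges. -/
open scoped Classical

/-- `G` contains a copy of `F`, i.e. a subgraph isomorphic to `F`. -/
def HasCopy {α V : Type*} (F : SimpleGraph α) (G : SimpleGraph V) : Prop :=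
  ∃ φ : α ↪ V, ∀ ⦃a b : α⦄, F.Adj a b → G.Adj (φ a) (φ b)

/-- `N(K_r, G)`: the number of copies of the complete graph `K_r` in `G`,
i.e. the number of `r`-cliques of `G`. -/
noncomputable def cliqueCount {V : Type*} (r : ℕ) (G : SimpleGraph V) : ℕ :=
  {s : Finset V | G.IsNClique r s}.ncard

/-- The number of edges of `G`. -/
noncomputable def edgeCount {V : Type*} (G : SimpleGraph V) : ℕ :=
  G.edgeSet.ncard

/-- The Turán number `ex(n, F)`: the maximum number of edges in an `F`-free graph
on `n` vertices. -/
noncomputable def exTuran {α : Type*} (n : ℕ) (F : SimpleGraph α) : ℕ :=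
  sSup {m | ∃ G : SimpleGraph (Fin n), ¬ HasCopy F G ∧ edgeCount G = m}

/-- The generalized Turán number `ex(n, K_r, F)`: the maximum number of copies of `K_r`
in an `F`-free graph on `n` vertices. -/
noncomputable def exClique {α : Type*} (n r : ℕ) (F : SimpleGraph α) : ℕ :=
  sSup {m | ∃ G : SimpleGraph (Fin n), ¬ HasCopy F G ∧ cliqueCount r G = m}

/-- The hypergraph `H` contains a Berge copy of the graph `F`: there is an injection `φ`
of the vertices of `F` and an injection `f` from the edges of `F` to the hyperedges of `H`
such that `φ '' e ⊆ f e` for every edge `e` of `F`. -/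
def HasBergeCopy {α V : Type*} (F : SimpleGraph α) (H : Finset (Finset V)) : Prop :=
  ∃ (φ : α ↪ V) (f : F.edgeSet → Finset V), Function.Injective f ∧
    ∀ e : F.edgeSet, f e ∈ H ∧ ∀ x ∈ (e : Sym2 α), φ x ∈ f e

/-- `ex_r(n, Berge-F)`: the maximum number of hyperedges in an `r`-uniform
Berge-`F`-free hypergraph on `n` vertices. -/
noncomputable def exBerge {α : Type*} (r n : ℕ) (F : SimpleGraph α) : ℕ :=
  sSup {m | ∃ H : Finset (Finset (Fin n)), (∀ e ∈ H, e.card = r) ∧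
    ¬ HasBergeCopy F H ∧ H.card = m}

/-- A hypergraph is linear if any two distinct hyperedges share at most one vertex. -/
def IsLinear {V : Type*} [DecidableEq V] (H : Finset (Finset V)) : Prop :=
  ∀ e₁ ∈ H, ∀ e₂ ∈ H, e₁ ≠ e₂ → (e₁ ∩ e₂).card ≤ 1

/-- `ex_r^{lin}(n, Berge-F)`: the maximum number of hyperedges in an `r`-uniform linear
Berge-`F`-free hypergraph on `n` vertices. -/
noncomputable def exBergeLin {α : Type*} (r n : ℕ) (F : SimpleGraph α) : ℕ :=
  sSup {m | ∃ H : Finset (Finset (Fin n)), (∀ e ∈ H, e.card = r) ∧ IsLinear H ∧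
    ¬ HasBergeCopy F H ∧ H.card = m}

/-- The graph obtained from `F₀` by subdividing the edge `uv`: delete the edge `uv` and
add a new vertex `none` joined to `u` and `v`. -/
def subdivideEdge {α : Type*} (F₀ : SimpleGraph α) (u v : α) : SimpleGraph (Option α) :=
  SimpleGraph.fromEdgeSet
    ((Sym2.map some '' F₀.edgeSet \ {s(some u, some v)}) ∪ {s(some u, none), s(some v, none)})


namespace RB
open Finset

/-- Weighted count of the sets satisfying `H`. -/
noncomputable def PP {V : Type*} [Fintype V] (H : Finset V → Prop) (w : V → ℕ) : ℕ :=
  ∑ S ∈ univ.filter H, ∏ i ∈ S, w i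

noncomputable def ind (p : Prop) : ℕ := if p then 1 else 0

lemma ind_mono {p q : Prop} (h : p → q) : ind p ≤ ind q := by
  unfold ind
  by_cases hp : p
  · simp [hp, h hp]
  · simp [hp]

lemma PP_two {V : Type*} [Fintype V] (H : Finset V → Prop) (w : V → ℕ) {p q : V} (hpq : p ≠ q) :
    PP H w = ∑ T ∈ ((univ.erase p).erase q).powerset, (∏ i ∈ T, w i) *
      (ind (H T) + w p * ind (H (insert p T)) + w q * ind (H (insert q T))
        + w p * w q * ind (H (insert p (insert q T)))) := by
  have hu : (univ : Finset V) = insert p (insert q ((univ.erase p).erase q)) := by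
    ext x
    by_cases h1 : x = p <;> by_cases h2 : x = q <;> simp [h1, h2]
  have hU : (univ : Finset (Finset V)) = (univ : Finset V).powerset := by simp
  unfold PP
  rw [sum_filter, hU]
  conv_lhs => rw [hu]
  rw [sum_powerset_insert (by simp [hpq]), sum_powerset_insert (by simp),
    sum_powerset_insert (by simp), ← sum_add_distrib, ← sum_add_distrib, ← sum_add_distrib]
  refine sum_congr rfl fun T hT => ?_
  have hT' := mem_powerset.1 hT
  have hp : p ∉ T := fun h => by simpa using hT' h
  have hq : q ∉ T := fun h => by simpa using hT' h
  have hp' : p ∉ insert q T := by simp [hp, hpq]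
  rw [prod_insert hp, prod_insert hq, prod_insert hp', prod_insert hq]
  unfold ind
  split_ifs <;> ring

lemma PP_affine {V : Type*} [Fintype V] (H : Finset V → Prop) (w : V → ℕ) {p q : V} (hpq : p ≠ q) :
    ∃ C A B D : ℕ, ((∀ S, H S → p ∈ S → q ∈ S → False) → D = 0) ∧
      ∀ w' : V → ℕ, (∀ x, x ≠ p → x ≠ q → w' x = w x) →
        PP H w' = C + w' p * A + w' q * B + w' p * w' q * D := by
  refine ⟨∑ T ∈ ((univ.erase p).erase q).powerset, (∏ i ∈ T, w i) * ind (H T),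
    ∑ T ∈ ((univ.erase p).erase q).powerset, (∏ i ∈ T, w i) * ind (H (insert p T)),
    ∑ T ∈ ((univ.erase p).erase q).powerset, (∏ i ∈ T, w i) * ind (H (insert q T)),
    ∑ T ∈ ((univ.erase p).erase q).powerset, (∏ i ∈ T, w i) * ind (H (insert p (insert q T))),
    ?_, ?_⟩
  · intro h
    refine sum_eq_zero fun T _ => ?_
    have : ¬ H (insert p (insert q T)) := fun hh => h _ hh (by simp) (by simp)
    simp [ind, this]
  · intro w' hw'
    rw [PP_two H w' hpq, mul_sum, mul_sum, mul_sum, ← sum_add_distrib, ← sum_add_distrib,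
      ← sum_add_distrib]
    refine sum_congr rfl fun T hT => ?_
    have hT' := mem_powerset.1 hT
    have : ∏ i ∈ T, w' i = ∏ i ∈ T, w i := by
      refine prod_congr rfl fun i hi => ?_
      have := hT' hi
      simp only [mem_erase, mem_univ, and_true, ne_eq] at this
      exact hw' i this.2 this.1
    rw [this]
    ring

/-- shifting weight between p and q -/
noncomputable def shift {V : Type*} (w : V → ℕ) (p q : V) (a b : ℕ) : V → ℕ :=
  fun x => if x = p then a else if x = q then b else w x

lemma sum_shift {V : Type*} [Fintype V] (w : V → ℕ) {p q : V} (hpq : p ≠ q) (a b : ℕ)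
    (h : a + b = w p + w q) : ∑ x, shift w p q a b x = ∑ x, w x := by
  have key : ∀ f : V → ℕ, ∑ x, f x = f p + (f q + ∑ x ∈ (univ.erase p).erase q, f x) := by
    intro f
    rw [← add_sum_erase _ f (mem_univ p), ← add_sum_erase _ f (show q ∈ univ.erase p by
      simp [hpq.symm])]
  rw [key, key w]
  have : ∑ x ∈ (univ.erase p).erase q, shift w p q a b x = ∑ x ∈ (univ.erase p).erase q, w x := by
    refine sum_congr rfl fun x hx => ?_
    simp only [mem_erase, mem_univ, and_true, ne_eq] at hx
    simp [shift, hx.1, hx.2]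
  rw [this]
  simp [shift, hpq.symm]
  omega

lemma zykov {V : Type*} [Fintype V] (G : SimpleGraph V) (H : Finset V → Prop)
    (hH : ∀ S : Finset V, H S → G.IsClique S) (N : ℕ) : ∀ (w : V → ℕ),
    (univ.filter (fun x => w x ≠ 0)).card ≤ N →
    ∃ w' : V → ℕ, ∑ x, w' x = ∑ x, w x ∧ PP H w ≤ PP H w' ∧
      G.IsClique {x | w' x ≠ 0} := by
  induction N with
  | zero =>
    intro w hw
    refine ⟨w, rfl, le_rfl, ?_⟩
    intro x hx
    have : x ∈ univ.filter (fun x => w x ≠ 0) := by simpa using hx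
    rw [card_eq_zero.1 (Nat.le_zero.1 hw)] at this
    simp at this
  | succ N ih =>
    intro w hw
    by_cases hc : G.IsClique {x | w x ≠ 0}
    · exact ⟨w, rfl, le_rfl, hc⟩
    have : ∃ p q, w p ≠ 0 ∧ w q ≠ 0 ∧ p ≠ q ∧ ¬ G.Adj p q := by
      by_contra hcon
      push Not at hcon
      exact hc fun p hp q hq hpq => hcon p q hp hq hpq
    obtain ⟨p, q, hp, hq, hpq, hadj⟩ := this
    obtain ⟨C, A, B, D, hD, hF⟩ := PP_affine H w hpq
    have hD0 : D = 0 := hD fun S hS h1 h2 => hadj (hH S hS h1 h2 hpq)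
    subst hD0
    have e0 := hF w (fun _ _ _ => rfl)
    have e1 := hF (shift w p q (w p + w q) 0) (fun x h1 h2 => by simp [shift, h1, h2])
    have e2 := hF (shift w p q 0 (w p + w q)) (fun x h1 h2 => by simp [shift, h1, h2])
    simp only [shift, if_true, hpq.symm, if_false] at e1 e2
    have step : ∀ w1 : V → ℕ, ∑ x, w1 x = ∑ x, w x → PP H w ≤ PP H w1 →
        (∀ x, w1 x ≠ 0 → w x ≠ 0) → (∃ x, w x ≠ 0 ∧ w1 x = 0) →
        ∃ w' : V → ℕ, ∑ x, w' x = ∑ x, w x ∧ PP H w ≤ PP H w' ∧ G.IsClique {x | w' x ≠ 0} := by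
      intro w1 h1 h2 h3 ⟨x, hx, hx1⟩
      have hlt : (univ.filter (fun x => w1 x ≠ 0)).card < (univ.filter (fun x => w x ≠ 0)).card := by
        apply card_lt_card
        refine ⟨fun y hy => by simpa using h3 y (by simpa using hy), fun h => ?_⟩
        have := h (show x ∈ _ by simpa using hx)
        simp [hx1] at this
      obtain ⟨w', a, b, c⟩ := ih w1 (by omega)
      exact ⟨w', a.trans h1, h2.trans b, c⟩
    rcases le_total A B with hAB | hAB
    · refine step (shift w p q 0 (w p + w q)) (sum_shift w hpq _ _ (by omega)) ?_ ?_ ⟨p, hp, ?_⟩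
      · rw [e0]; refine le_trans ?_ (le_of_eq e2.symm); nlinarith [Nat.mul_le_mul_left (w p) hAB]
      · intro x hx
        by_cases h1 : x = p
        · subst h1; exact hp
        by_cases h2 : x = q
        · subst h2; exact hq
        simpa [shift, h1, h2] using hx
      · simp [shift]
    · refine step (shift w p q (w p + w q) 0) (sum_shift w hpq _ _ (by omega)) ?_ ?_ ⟨q, hq, ?_⟩
      · rw [e0]; refine le_trans ?_ (le_of_eq e1.symm); nlinarith [Nat.mul_le_mul_left (w q) hAB]
      · intro x hx
        by_cases h1 : x = p
        · subst h1; exact hp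
        by_cases h2 : x = q
        · subst h2; exact hq
        simpa [shift, h1, h2] using hx
      · simp [shift, hpq.symm]

/-- transport along an embedding -/
lemma PP_embed {U V : Type*} [Fintype U] [Fintype V] (e : U ↪ V) (H : Finset V → Prop)
    (w : V → ℕ) (hw : ∀ x, w x ≠ 0 → ∃ u, e u = x) :
    PP H w = PP (fun S : Finset U => H (S.map e)) (fun u => w (e u)) := by
  unfold PP
  have h2 : ∑ S ∈ univ.filter (fun S : Finset U => H (S.map e)), ∏ i ∈ S, w (e i)
      = ∑ S ∈ (univ.filter (fun S : Finset U => H (S.map e))).map (mapEmbedding e).toEmbedding,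
        ∏ i ∈ S, w i := by
    rw [sum_map]
    refine sum_congr rfl fun S _ => ?_
    simp [mapEmbedding_apply, prod_map]
  rw [h2]
  symm
  apply sum_subset
  · intro S hS
    simp only [mem_map, mem_filter, mem_univ, true_and] at hS ⊢
    obtain ⟨T, hT, rfl⟩ := hS
    exact hT
  · intro S hS hS'
    by_contra hne
    apply hS'
    have hne := prod_ne_zero_iff.1 hne
    have hS1 : H S := by simpa using hS
    have : (S.preimage e e.injective.injOn).map e = S := by
      ext x
      simp only [mem_map, mem_preimage]
      constructor
      · rintro ⟨a, ha, rfl⟩; exact ha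
      · intro hx
        obtain ⟨u, rfl⟩ := hw x (hne x hx)
        exact ⟨u, hx, rfl⟩
    simp only [mem_map, mem_filter, mem_univ, true_and]
    exact ⟨S.preimage e e.injective.injOn, by rw [this]; exact hS1, this⟩

lemma PP_le {V : Type*} [Fintype V] {H H' : Finset V → Prop} (w : V → ℕ) (h : ∀ S, H S → H' S) :
    PP H w ≤ PP H' w := by
  unfold PP
  apply sum_le_sum_of_subset
  intro S hS
  simp only [mem_filter, mem_univ, true_and] at hS ⊢
  exact h S hS

lemma PP_perm {V : Type*} [Fintype V] (r : ℕ) (σ : Equiv.Perm V) (w : V → ℕ) :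
    PP (fun S : Finset V => S.card = r) w = PP (fun S => S.card = r) (fun x => w (σ x)) := by
  rw [PP_embed σ.toEmbedding _ w (fun x _ => ⟨σ.symm x, by simp⟩)]
  simp

lemma balance {V : Type*} [Fintype V] (r : ℕ) (t : V → ℕ) (ht : ∀ i j, t j ≤ t i + 1) (N : ℕ) :
    ∀ w : V → ℕ, ∑ x, w x = ∑ x, t x → ∑ x, (w x - t x) ≤ N →
    PP (fun S => S.card = r) w ≤ PP (fun S => S.card = r) t := by
  induction N with
  | zero =>
    intro w h1 h2
    have h3 : ∀ x, w x ≤ t x := by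
      intro x
      have := (sum_eq_zero_iff.1 (Nat.le_zero.1 h2)) x (mem_univ x)
      omega
    have : w = t := by
      funext x
      exact (sum_eq_sum_iff_of_le (fun i _ => h3 i)).1 h1 x (mem_univ x)
    rw [this]
  | succ N ih =>
    intro w h1 h2
    by_cases h3 : ∀ x, w x ≤ t x
    · have : w = t := by
        funext x
        exact (sum_eq_sum_iff_of_le (fun i _ => h3 i)).1 h1 x (mem_univ x)
      rw [this]
    push Not at h3
    obtain ⟨p, hp⟩ := h3
    have : ∃ q, w q < t q := by
      by_contra hcon
      push Not at hcon
      have := sum_lt_sum (fun i (_ : i ∈ univ) => hcon i) ⟨p, mem_univ p, hp⟩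
      omega
    obtain ⟨q, hq⟩ := this
    have hpq : p ≠ q := by rintro rfl; omega
    obtain ⟨C, A, B, D, _, hF⟩ := PP_affine (fun S : Finset V => S.card = r) w hpq
    have hsw : ∀ a b, PP (fun S : Finset V => S.card = r) (shift w p q a b)
        = PP (fun S : Finset V => S.card = r) (shift w p q b a) := by
      intro a b
      rw [PP_perm r (Equiv.swap p q)]
      congr 1
      funext x
      by_cases h1 : x = p
      · subst h1; simp [shift, hpq.symm]
      by_cases h2 : x = q
      · subst h2; simp [shift, hpq.symm]
      rw [Equiv.swap_apply_of_ne_of_ne h1 h2]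
      simp [shift, h1, h2]
    have hv : ∀ a b, PP (fun S : Finset V => S.card = r) (shift w p q a b)
        = C + a * A + b * B + a * b * D := by
      intro a b
      rw [hF (shift w p q a b) (fun x h1 h2 => by simp [shift, h1, h2])]
      simp [shift, hpq.symm]
    have hAB : A = B := by
      have := hsw 1 0
      rw [hv, hv] at this
      omega
    subst hAB
    have e0 := hF w (fun _ _ _ => rfl)
    have ht' := ht p q
    have hs := sum_shift w hpq (w p - 1) (w q + 1) (by omega)
    refine le_trans ?_ (ih (shift w p q (w p - 1) (w q + 1)) (hs.trans h1) ?_)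
    · rw [hv, e0]
      obtain ⟨a, ha⟩ : ∃ a, w p = w q + 1 + a := ⟨w p - w q - 1, by omega⟩
      have : w p - 1 = w q + a := by omega
      rw [this, ha]
      nlinarith [Nat.zero_le (a * D)]
    · have : ∑ x, (shift w p q (w p - 1) (w q + 1) x - t x) < ∑ x, (w x - t x) := by
        apply sum_lt_sum
        · intro x _
          by_cases h1 : x = p
          · subst h1; simp [shift]; omega
          by_cases h2 : x = q
          · subst h2; simp [shift, hpq.symm]; omega
          simp [shift, h1, h2]
        · refine ⟨p, mem_univ p, ?_⟩
          simp [shift]; omega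
      omega

end RB

namespace RB
open Finset

lemma cliqueCount_eq {V : Type*} [Fintype V] (r : ℕ) (G : SimpleGraph V) :
    cliqueCount r G = (univ.filter (fun S : Finset V => G.IsNClique r S)).card := by
  unfold cliqueCount
  rw [← Set.ncard_coe_finset]
  congr 1
  ext S
  simp

lemma edgeCount_eq {V : Type*} [Fintype V] (G : SimpleGraph V) :
    edgeCount G = cliqueCount 2 G := by
  unfold edgeCount cliqueCount
  symm
  have hi : Function.Injective (fun e : Sym2 V => e.toFinset) := by
    intro a b h
    ext x
    have := congrArg (fun s : Finset V => x ∈ s) h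
    simpa [Sym2.mem_toFinset] using this
  rw [← Set.ncard_image_of_injective G.edgeSet hi]
  congr 1
  ext S
  simp only [Set.mem_setOf_eq, Set.mem_image]
  constructor
  · intro h
    obtain ⟨a, b, hab, rfl⟩ := card_eq_two.1 h.card_eq
    refine ⟨s(a, b), ?_, ?_⟩
    · exact h.isClique (by simp) (by simp) hab
    · ext x; simp [Sym2.mem_toFinset]
  · rintro ⟨e, he, rfl⟩
    induction e with
    | _ a b =>
      have hadj : G.Adj a b := he
      have : (s(a, b) : Sym2 V).toFinset = {a, b} := by ext x; simp [Sym2.mem_toFinset]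
      rw [this]
      refine ⟨?_, card_pair hadj.ne⟩
      intro x hx y hy hxy
      simp at hx hy
      rcases hx with rfl | rfl <;> rcases hy with rfl | rfl
      · exact absurd rfl hxy
      · exact hadj
      · exact hadj.symm
      · exact absurd rfl hxy

noncomputable def tsize (n m : ℕ) (j : Fin m) : ℕ :=
  (univ.filter (fun x : Fin n => (x : ℕ) % m = j)).card

lemma tsize_bal (n m : ℕ) (i j : Fin m) : tsize n m j ≤ tsize n m i + 1 := by
  have hm : 0 < m := i.pos
  have key : ∀ j : Fin m, tsize n m j = n / m + if (j : ℕ) % m < n % m then 1 else 0 := by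
    intro j
    rw [← Nat.count_modEq_card _ hm, Nat.count_eq_card_filter_range]
    unfold tsize
    have hj : (j : ℕ) % m = j := Nat.mod_eq_of_lt j.2
    rw [← card_map Fin.valEmbedding]
    congr 1
    ext x
    simp only [mem_map, mem_filter, mem_univ, true_and, Fin.valEmbedding_apply, mem_range,
      Nat.ModEq, hj]
    constructor
    · rintro ⟨a, ha, rfl⟩; exact ⟨a.2, ha⟩
    · rintro ⟨h1, h2⟩; exact ⟨⟨x, h1⟩, h2, rfl⟩
  rw [key, key]
  split_ifs <;> omega

lemma tsize_sum (n m : ℕ) (hm : 0 < m) : ∑ j, tsize n m j = n := by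
  have := card_eq_sum_card_fiberwise (s := (univ : Finset (Fin n))) (t := (univ : Finset (Fin m)))
    (f := fun x : Fin n => (⟨(x : ℕ) % m, Nat.mod_lt _ hm⟩ : Fin m)) (by intro x _; simp)
  rw [card_univ, Fintype.card_fin] at this
  refine Eq.trans ?_ this.symm
  refine sum_congr rfl fun j _ => ?_
  unfold tsize
  refine congrArg Finset.card ?_
  ext x
  simp [Fin.ext_iff]

lemma tsize_PP (n m r : ℕ) (hm : 0 < m) :
    PP (fun S : Finset (Fin m) => S.card = r) (tsize n m)
      ≤ cliqueCount r (SimpleGraph.turanGraph n m) := by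
  let c : Fin n → Fin m := fun x => ⟨(x : ℕ) % m, Nat.mod_lt _ hm⟩
  have hadj : ∀ x y : Fin n, (SimpleGraph.turanGraph n m).Adj x y ↔ c x ≠ c y := by
    intro x y
    simp [SimpleGraph.turanGraph_adj, c]
  have hts : ∀ j, tsize n m j = (univ.filter (fun x => c x = j)).card := by
    intro j
    unfold tsize
    congr 1
    ext x
    simp [c, Fin.ext_iff]
  rw [cliqueCount_eq]
  have h1 : (univ.filter (fun S : Finset (Fin n) => (SimpleGraph.turanGraph n m).IsNClique r S)).card
      = ∑ T ∈ (univ.filter (fun T : Finset (Fin m) => T.card = r)),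
        ((univ.filter (fun S : Finset (Fin n) =>
          (SimpleGraph.turanGraph n m).IsNClique r S)).filter (fun S => S.image c = T)).card := by
    apply card_eq_sum_card_fiberwise
    intro S hS
    have hS : (SimpleGraph.turanGraph n m).IsNClique r S := by simpa using hS
    simp only [coe_filter, mem_univ, true_and, Set.mem_setOf_eq]
    rw [card_image_of_injOn, hS.card_eq]
    intro x hx y hy hxy
    by_contra hne
    exact (hadj x y).1 (hS.isClique hx hy hne) hxy
  refine le_trans (b := ∑ T ∈ (univ.filter (fun T : Finset (Fin m) => T.card = r)),
        ((univ.filter (fun S : Finset (Fin n) =>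
          (SimpleGraph.turanGraph n m).IsNClique r S)).filter (fun S => S.image c = T)).card) ?_
    (le_of_eq (by rw [← h1]; congr!))
  have h0 : PP (fun S : Finset (Fin m) => S.card = r) (tsize n m) =
      ∑ T ∈ (univ.filter (fun T : Finset (Fin m) => T.card = r)), ∏ i ∈ T, tsize n m i := by
    unfold PP
    congr!
  rw [h0]
  refine sum_le_sum fun T hT => ?_
  have hT : T.card = r := by simpa using hT
  have h2 : ∏ i ∈ T, tsize n m i = (T.pi (fun j => univ.filter (fun x => c x = j))).card := by
    rw [card_pi]
    exact prod_congr rfl fun j _ => hts j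
  rw [h2]
  have hg : ∀ g ∈ T.pi (fun j => univ.filter (fun x => c x = j)), ∀ j (hj : j ∈ T), c (g j hj) = j := by
    intro g hg j hj
    simpa using (mem_pi.1 hg) j hj
  apply card_le_card_of_injOn (fun g => T.attach.image (fun i => g i.1 i.2))
  · intro g hgm
    have hc := hg g hgm
    simp only [coe_filter, mem_filter, mem_univ, true_and, Set.mem_setOf_eq]
    refine ⟨⟨?_, ?_⟩, ?_⟩
    · intro x hx y hy hxy
      simp only [coe_image, Set.mem_image] at hx hy
      obtain ⟨i, _, rfl⟩ := hx
      obtain ⟨j, _, rfl⟩ := hy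
      rw [hadj, hc, hc]
      intro h
      apply hxy
      have : i = j := Subtype.ext h
      rw [this]
    · rw [card_image_of_injOn, card_attach, hT]
      intro i _ j _ h
      have := congrArg c h
      simp only [hc] at this
      exact Subtype.ext this
    · ext j
      simp only [mem_image, mem_attach, true_and]
      constructor
      · rintro ⟨x, ⟨i, rfl⟩, rfl⟩
        rw [hc]; exact i.2
      · intro hj
        exact ⟨g j hj, ⟨⟨j, hj⟩, rfl⟩, hc j hj⟩
  · intro g hgm g' hgm' h
    have hc := hg g hgm
    have hc' := hg g' hgm'
    funext j hj
    have : g j hj ∈ T.attach.image (fun i => g' i.1 i.2) := by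
      have h : T.attach.image (fun i => g i.1 i.2) = T.attach.image (fun i => g' i.1 i.2) := h
      rw [← h]
      exact mem_image.2 ⟨⟨j, hj⟩, mem_attach _ _, rfl⟩
    obtain ⟨i, _, hi⟩ := mem_image.1 this
    have e := congrArg c hi
    rw [hc, hc'] at e
    obtain ⟨i, hi'⟩ := i
    simp only at e hi
    subst e
    exact hi.symm

lemma esymm_le_turan {V : Type*} [Fintype V] (r m n : ℕ) (hm : 0 < m) (w : V → ℕ)
    (hs : (univ.filter (fun x => w x ≠ 0)).card ≤ m) (hn : ∑ x, w x = n) :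
    PP (fun S : Finset V => S.card = r) w ≤ cliqueCount r (SimpleGraph.turanGraph n m) := by
  set K := univ.filter (fun x => w x ≠ 0) with hK
  have e1 := PP_embed (Function.Embedding.subtype (fun x => x ∈ K)) (fun S : Finset V => S.card = r) w
    (fun x hx => ⟨⟨x, by simpa [hK] using hx⟩, rfl⟩)
  obtain ⟨e⟩ : Nonempty ({x // x ∈ K} ↪ Fin m) := by
    apply Function.Embedding.nonempty_of_card_le
    simpa using hs
  let w2 : Fin m → ℕ := fun j => if h : ∃ u, e u = j then w (h.choose : V) else 0
  have hw2 : ∀ u, w2 (e u) = w u := by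
    intro u
    have h : ∃ u', e u' = e u := ⟨u, rfl⟩
    have : h.choose = u := e.injective h.choose_spec
    simp only [w2]
    rw [dif_pos h, this]
  have hw2' : ∀ x, w2 x ≠ 0 → ∃ u, e u = x := by
    intro x hx
    by_contra hcon
    exact hx (by simp only [w2]; rw [dif_neg hcon])
  have e2 := PP_embed e (fun S : Finset (Fin m) => S.card = r) w2 hw2'
  have hsum : ∑ j, w2 j = n := by
    rw [← hn]
    have a1 : ∑ x, w x = ∑ x ∈ K, w x := by
      symm
      apply sum_subset (subset_univ _)
      intro x _ hx
      simpa [hK] using hx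
    have a2 : ∑ j, w2 j = ∑ j ∈ univ.map e, w2 j := by
      symm
      apply sum_subset (subset_univ _)
      intro x _ hx
      by_contra h
      obtain ⟨u, hu⟩ := hw2' x h
      exact hx (by simp [← hu])
    rw [a1, a2, sum_map]
    exact (sum_congr rfl fun u _ => hw2 u).trans (sum_coe_sort K w)
  have : PP (fun S : Finset V => S.card = r) w = PP (fun S : Finset (Fin m) => S.card = r) w2 := by
    rw [e1, e2]
    simp [hw2]
  rw [this]
  refine le_trans (balance r (tsize n m) (tsize_bal n m) _ w2 ?_ le_rfl) (tsize_PP n m r hm)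
  rw [hsum, tsize_sum n m hm]

end RB

namespace RB
open Finset

def Ind {V : Type*} (R : SimpleGraph V) (S : Finset V) : Prop := ∀ x ∈ S, ∀ y ∈ S, ¬ R.Adj x y

def HH {V : Type*} (r : ℕ) (R : SimpleGraph V) (S : Finset V) : Prop :=
  (S.card = 2 ∧ R.IsClique S) ∨ (S.card = r ∧ Ind R S)

/-- sum over sets avoiding u and v -/
noncomputable def EE {V : Type*} [Fintype V] (w : V → ℕ) (u v : V) (f : Finset V → Prop) : ℕ :=
  ∑ T ∈ univ.filter (fun T : Finset V => u ∉ T ∧ v ∉ T), (∏ i ∈ T, w i) * ind (f T)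

lemma EE_comm {V : Type*} [Fintype V] (w : V → ℕ) (u v : V) (f : Finset V → Prop) :
    EE w u v f = EE w v u f := by
  unfold EE
  refine sum_congr ?_ fun _ _ => rfl
  ext T
  simp [and_comm]

lemma EE_congr {V : Type*} [Fintype V] (w : V → ℕ) (u v : V) {f g : Finset V → Prop}
    (h : ∀ T, u ∉ T → v ∉ T → (f T ↔ g T)) : EE w u v f = EE w u v g := by
  unfold EE
  refine sum_congr rfl fun T hT => ?_
  simp only [mem_filter, mem_univ, true_and] at hT
  rw [propext (h T hT.1 hT.2)]

lemma EE_mono {V : Type*} [Fintype V] (w : V → ℕ) (u v : V) {f g : Finset V → Prop}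
    (h : ∀ T, u ∉ T → v ∉ T → f T → g T) : EE w u v f ≤ EE w u v g := by
  unfold EE
  refine sum_le_sum fun T hT => ?_
  simp only [mem_filter, mem_univ, true_and] at hT
  exact Nat.mul_le_mul_left _ (ind_mono (h T hT.1 hT.2))

lemma EE_strict {V : Type*} [Fintype V] (w : V → ℕ) (hw : ∀ x, 0 < w x) (u v : V)
    {f g : Finset V → Prop}
    (h : ∀ T, u ∉ T → v ∉ T → f T → g T) (he : EE w u v g ≤ EE w u v f)
    (T : Finset V) (hu : u ∉ T) (hv : v ∉ T) (hg : g T) : f T := by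
  by_contra hf
  have : EE w u v f < EE w u v g := by
    unfold EE
    refine sum_lt_sum ?_ ⟨T, by simp [hu, hv], ?_⟩
    · intro T hT
      simp only [mem_filter, mem_univ, true_and] at hT
      exact Nat.mul_le_mul_left _ (ind_mono (h T hT.1 hT.2))
    · have : 0 < ∏ i ∈ T, w i := prod_pos fun i _ => hw i
      simp [ind, hf, hg, this]
  omega

lemma PP_EE {V : Type*} [Fintype V] (H : Finset V → Prop) (w : V → ℕ) {u v : V} (huv : u ≠ v) :
    PP H w = EE w u v H + w u * EE w u v (fun T => H (insert u T))
      + w v * EE w u v (fun T => H (insert v T))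
      + w u * w v * EE w u v (fun T => H (insert u (insert v T))) := by
  rw [PP_two H w huv]
  unfold EE
  rw [mul_sum, mul_sum, mul_sum, ← sum_add_distrib, ← sum_add_distrib, ← sum_add_distrib]
  have : ((univ.erase u).erase v).powerset = univ.filter (fun T : Finset V => u ∉ T ∧ v ∉ T) := by
    ext T
    simp only [mem_powerset, mem_filter, mem_univ, true_and]
    constructor
    · intro h
      exact ⟨fun h1 => by simpa using h h1, fun h1 => by simpa using h h1⟩
    · rintro ⟨h1, h2⟩ x hx
      simp only [mem_erase, mem_univ, and_true]
      exact ⟨fun h => h2 (h ▸ hx), fun h => h1 (h ▸ hx)⟩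
  rw [this]
  refine sum_congr rfl fun T _ => ?_
  ring

/-- make `u` a (blue) twin of `v` -/
noncomputable def twin {V : Type*} (R : SimpleGraph V) (u v : V) : SimpleGraph V :=
  R.comap (fun x => if x = u then v else x)

lemma twin_cliqueFree {V : Type*} (R : SimpleGraph V) (u v : V) (r : ℕ) (h : R.CliqueFree r) :
    (twin R u v).CliqueFree r := by
  intro S hS
  apply h (S.image (fun x => if x = u then v else x))
  have hinj : Set.InjOn (fun x => if x = u then v else x) (S : Set V) := by
    intro x hx y hy hxy
    by_contra hne
    have : R.Adj _ _ := hS.isClique hx hy hne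
    exact this.ne hxy
  refine ⟨?_, by rw [card_image_of_injOn hinj, hS.card_eq]⟩
  intro x hx y hy hxy
  simp only [coe_image, Set.mem_image] at hx hy
  obtain ⟨a, ha, rfl⟩ := hx
  obtain ⟨b, hb, rfl⟩ := hy
  have hab : a ≠ b := by rintro rfl; exact hxy rfl
  exact hS.isClique ha hb hab

lemma twin_adj {V : Type*} (R : SimpleGraph V) {u v : V} {x y : V} (hx : x ≠ u) (hy : y ≠ u) :
    (twin R u v).Adj x y ↔ R.Adj x y := by
  simp [twin, hx, hy]

lemma twin_adj_u {V : Type*} (R : SimpleGraph V) {u v : V} {y : V} (hy : y ≠ u) :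
    (twin R u v).Adj u y ↔ R.Adj v y := by
  simp [twin, hy]

lemma HH_congr {V : Type*} (r : ℕ) {R R' : SimpleGraph V} {S : Finset V}
    (h : ∀ x ∈ S, ∀ y ∈ S, (R.Adj x y ↔ R'.Adj x y)) : HH r R S ↔ HH r R' S := by
  unfold HH
  refine or_congr (and_congr_right fun _ => ?_) (and_congr_right fun _ => ?_)
  · constructor
    · intro hc x hx y hy hxy; exact (h x hx y hy).1 (hc hx hy hxy)
    · intro hc x hx y hy hxy; exact (h x hx y hy).2 (hc hx hy hxy)
  · constructor
    · intro hc x hx y hy hxy; exact hc x hx y hy ((h x hx y hy).2 hxy)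
    · intro hc x hx y hy hxy; exact hc x hx y hy ((h x hx y hy).1 hxy)

lemma isClique_insert_iff {V : Type*} (R : SimpleGraph V) (a : V) (T : Finset V) (ha : a ∉ T) :
    R.IsClique (insert a T : Finset V) ↔ R.IsClique T ∧ ∀ b ∈ T, R.Adj a b := by
  rw [coe_insert, SimpleGraph.isClique_insert_of_notMem (by simpa using ha)]
  simp

lemma ind_insert_iff {V : Type*} (R : SimpleGraph V) (a : V) (T : Finset V) :
    Ind R (insert a T) ↔ Ind R T ∧ ∀ b ∈ T, ¬ R.Adj a b := by
  unfold Ind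
  simp only [mem_insert, forall_eq_or_imp, SimpleGraph.irrefl, not_false_eq_true, true_and]
  constructor
  · rintro ⟨h1, h2⟩
    exact ⟨fun x hx y hy => (h2 x hx).2 y hy, h1⟩
  · rintro ⟨h1, h2⟩
    exact ⟨h2, fun x hx => ⟨fun h => h2 x hx h.symm, h1 x hx⟩⟩

lemma half {V : Type*} [Fintype V] (r : ℕ) (hr : 3 ≤ r) (w : V → ℕ) (hw : ∀ x, 0 < w x)
    (R : SimpleGraph V) (hR : R.CliqueFree r)
    (hmax : ∀ R' : SimpleGraph V, R'.CliqueFree r → PP (HH r R') w ≤ PP (HH r R) w)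
    {u v : V} (huv : u ≠ v) :
    EE w u v (fun T => HH r R (insert v T)) +
      w v * EE w u v (fun T => (insert u (insert v T)).card = r ∧ Ind R (insert v T))
    ≤ EE w u v (fun T => HH r R (insert u T)) +
      w v * EE w u v (fun T => HH r R (insert u (insert v T))) := by
  have h := hmax _ (twin_cliqueFree R u v r hR)
  rw [PP_EE _ w huv, PP_EE (HH r R) w huv] at h
  have hne : ∀ T : Finset V, u ∉ T → ∀ x ∈ T, x ≠ u := fun T hT x hx h => hT (h ▸ hx)
  have h0 : EE w u v (HH r (twin R u v)) = EE w u v (HH r R) := by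
    refine EE_congr w u v fun T hu hv => HH_congr r fun x hx y hy => ?_
    exact twin_adj R (hne T hu x hx) (hne T hu y hy)
  have h1 : EE w u v (fun T => HH r (twin R u v) (insert v T))
      = EE w u v (fun T => HH r R (insert v T)) := by
    refine EE_congr w u v fun T hu hv => HH_congr r fun x hx y hy => ?_
    have hu' : u ∉ insert v T := by simp [huv, hu]
    exact twin_adj R (hne _ hu' x hx) (hne _ hu' y hy)
  have hT1 : ∀ T : Finset V, u ∉ T → ((twin R u v).IsClique T ↔ R.IsClique T) := by
    intro T hu
    constructor
    · intro hc x hx y hy hxy; exact (twin_adj R (hne T hu x hx) (hne T hu y hy)).1 (hc hx hy hxy)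
    · intro hc x hx y hy hxy; exact (twin_adj R (hne T hu x hx) (hne T hu y hy)).2 (hc hx hy hxy)
  have hT2 : ∀ T : Finset V, u ∉ T → (Ind (twin R u v) T ↔ Ind R T) := by
    intro T hu
    constructor
    · intro hc x hx y hy hxy; exact hc x hx y hy ((twin_adj R (hne T hu x hx) (hne T hu y hy)).2 hxy)
    · intro hc x hx y hy hxy; exact hc x hx y hy ((twin_adj R (hne T hu x hx) (hne T hu y hy)).1 hxy)
  have hT3 : ∀ T : Finset V, u ∉ T → v ∉ T → (Ind (twin R u v) (insert u T) ↔ Ind R (insert v T)) := by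
    intro T hu hv
    rw [ind_insert_iff, ind_insert_iff, hT2 T hu]
    refine and_congr_right fun _ => ⟨fun h b hb => ?_, fun h b hb => ?_⟩
    · rw [← twin_adj_u R (hne T hu b hb)]; exact h b hb
    · rw [twin_adj_u R (hne T hu b hb)]; exact h b hb
  have h2 : EE w u v (fun T => HH r (twin R u v) (insert u T))
      = EE w u v (fun T => HH r R (insert v T)) := by
    refine EE_congr w u v fun T hu hv => ?_
    unfold HH
    rw [hT3 T hu hv, card_insert_of_notMem hu, card_insert_of_notMem hv,
      isClique_insert_iff _ _ _ hu, isClique_insert_iff _ _ _ hv, hT1 T hu]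
    refine or_congr (and_congr_right fun _ => and_congr_right fun _ =>
      ⟨fun h b hb => ?_, fun h b hb => ?_⟩) Iff.rfl
    · rw [← twin_adj_u R (hne T hu b hb)]; exact h b hb
    · rw [twin_adj_u R (hne T hu b hb)]; exact h b hb
  have h3 : EE w u v (fun T => (insert u (insert v T)).card = r ∧ Ind R (insert v T))
      ≤ EE w u v (fun T => HH r (twin R u v) (insert u (insert v T))) := by
    refine EE_mono w u v fun T hu hv hT => Or.inr ⟨hT.1, ?_⟩
    have hu' : u ∉ insert v T := by simp [huv, hu]
    rw [ind_insert_iff, hT2 _ hu']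
    refine ⟨hT.2, fun b hb => ?_⟩
    rw [twin_adj_u R (hne _ hu' b hb)]
    exact hT.2 v (by simp) b hb
  rw [h0, h1, h2] at h
  have h3' := Nat.mul_le_mul_left (w u * w v) h3
  have : w u * (EE w u v (fun T => HH r R (insert v T)) +
      w v * EE w u v (fun T => (insert u (insert v T)).card = r ∧ Ind R (insert v T)))
    ≤ w u * (EE w u v (fun T => HH r R (insert u T)) +
      w v * EE w u v (fun T => HH r R (insert u (insert v T)))) := by
    nlinarith
  exact Nat.le_of_mul_le_mul_left this (hw u)

lemma star {V : Type*} [Fintype V] (r : ℕ) (hr : 3 ≤ r) (w : V → ℕ) (hw : ∀ x, 0 < w x)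
    (R : SimpleGraph V) (hR : R.CliqueFree r)
    (hmax : ∀ R' : SimpleGraph V, R'.CliqueFree r → PP (HH r R') w ≤ PP (HH r R) w)
    {u v : V} (huv : u ≠ v) (hadj : ¬ R.Adj u v) (Q : Finset V) (hQ : Q.card = r - 1)
    (hQI : Ind R Q) (hvQ : v ∈ Q) (huQ : u ∉ Q) : Ind R (insert u Q) := by
  have k1 := half r hr w hw R hR hmax huv
  have k2 := half r hr w hw R hR hmax huv.symm
  rw [EE_comm w v u, EE_comm w v u, EE_comm w v u, EE_comm w v u] at k2
  have hcard : ∀ T : Finset V, u ∉ T → v ∉ T → (insert u (insert v T)).card = T.card + 2 := by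
    intro T hu hv
    rw [card_insert_of_notMem (by simp [huv, hu]), card_insert_of_notMem hv]
  have hs : ∀ T : Finset V, u ∉ T → v ∉ T → HH r R (insert u (insert v T)) →
      (insert u (insert v T)).card = r ∧ Ind R (insert u (insert v T)) := by
    intro T hu hv hT
    rcases hT with hT | hT
    · exact absurd (hT.2 (by simp) (by simp) huv) hadj
    · exact hT
  have m1 : EE w u v (fun T => HH r R (insert u (insert v T))) ≤
      EE w u v (fun T => (insert u (insert v T)).card = r ∧ Ind R (insert v T)) :=
    EE_mono w u v fun T hu hv hT => ⟨(hs T hu hv hT).1,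
      fun x hx y hy => (hs T hu hv hT).2 x (mem_insert_of_mem hx) y (mem_insert_of_mem hy)⟩
  have m2 : EE w u v (fun T => HH r R (insert v (insert u T))) ≤
      EE w u v (fun T => (insert v (insert u T)).card = r ∧ Ind R (insert u T)) := by
    refine EE_mono w u v fun T hu hv hT => ?_
    rw [insert_comm v u T] at hT ⊢
    exact ⟨(hs T hu hv hT).1, fun x hx y hy => (hs T hu hv hT).2 x
      (by rw [insert_comm u v T]; exact mem_insert_of_mem hx) y
      (by rw [insert_comm u v T]; exact mem_insert_of_mem hy)⟩
  have m2' := Nat.mul_le_mul_left (w u) m2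
  have m3 : w v * EE w u v (fun T => (insert u (insert v T)).card = r ∧ Ind R (insert v T))
      ≤ w v * EE w u v (fun T => HH r R (insert u (insert v T))) := by omega
  have m4 := Nat.le_of_mul_le_mul_left m3 (hw v)
  have hT := EE_strict w hw u v (f := fun T => HH r R (insert u (insert v T)))
    (g := fun T => (insert u (insert v T)).card = r ∧ Ind R (insert v T))
    (fun T hu hv hT => ⟨(hs T hu hv hT).1,
      fun x hx y hy => (hs T hu hv hT).2 x (mem_insert_of_mem hx) y (mem_insert_of_mem hy)⟩)
    m4 (Q.erase v) (fun h => huQ (mem_of_mem_erase h)) (by simp)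
    (by
      rw [hcard _ (fun h => huQ (mem_of_mem_erase h)) (by simp), insert_erase hvQ,
        card_erase_of_mem hvQ]
      exact ⟨by omega, hQI⟩)
  have := (hs _ (fun h => huQ (mem_of_mem_erase h)) (by simp) hT).2
  rwa [insert_erase hvQ] at this

end RB

namespace RB
open Finset

lemma component {V : Type*} [Fintype V] (r : ℕ) (hr : 3 ≤ r) (w : V → ℕ) (hw : ∀ x, 0 < w x)
    (R : SimpleGraph V) (hR : R.CliqueFree r)
    (hmax : ∀ R' : SimpleGraph V, R'.CliqueFree r → PP (HH r R') w ≤ PP (HH r R) w)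
    (Q : Finset V) (hQ : Q.card = r) (hQI : Ind R Q) (v : V) (hv : v ∈ Q) :
    (∀ x y, ¬ R.Adj v x → ¬ R.Adj v y → ¬ R.Adj x y) ∧
    (∀ x y, ¬ R.Adj v x → R.Adj v y → R.Adj x y) := by
  have hsub : ∀ {S T : Finset V}, S ⊆ T → Ind R T → Ind R S :=
    fun h hI x hx y hy => hI x (h hx) y (h hy)
  have c1 : ∀ u, ¬ R.Adj v u → ∃ Q' : Finset V, Q'.card = r - 1 ∧ Ind R Q' ∧ v ∈ Q' ∧ u ∈ Q' := by
    intro u hu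
    have : ∃ Q2 : Finset V, r - 1 ≤ Q2.card ∧ Ind R Q2 ∧ v ∈ Q2 ∧ u ∈ Q2 := by
      by_cases huQ : u ∈ Q
      · exact ⟨Q, by omega, hQI, hv, huQ⟩
      · obtain ⟨Q1, h1, h2, h3⟩ := exists_subsuperset_card_eq (s := {v}) (t := Q) (n := r - 1)
          (by simpa using hv) (by simp; omega) (by omega)
        have huQ1 : u ∉ Q1 := fun h => huQ (h2 h)
        have hvQ1 : v ∈ Q1 := h1 (by simp)
        have := star r hr w hw R hR hmax (u := u) (v := v) (fun h => huQ1 (h ▸ hvQ1))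
          (fun h => hu h.symm) Q1 h3 (hsub h2 hQI) hvQ1 huQ1
        refine ⟨insert u Q1, ?_, this, by simp [hvQ1], by simp⟩
        rw [card_insert_of_notMem huQ1]; omega
    obtain ⟨Q2, a1, a2, a3, a4⟩ := this
    obtain ⟨Q1, h1, h2, h3⟩ := exists_subsuperset_card_eq (s := {v, u}) (t := Q2) (n := r - 1)
          (by intro x; simp only [mem_insert, mem_singleton]; rintro (rfl | rfl) <;> assumption)
          (card_le_two.trans (by omega)) a1
    exact ⟨Q1, h3, hsub h2 a2, h1 (by simp), h1 (by simp)⟩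
  refine ⟨fun x y hx hy => ?_, fun x y hx hy => ?_⟩
  · obtain ⟨Q', h1, h2, h3, h4⟩ := c1 x hx
    by_cases hyQ : y ∈ Q'
    · exact h2 x h4 y hyQ
    · have := star r hr w hw R hR hmax (u := y) (v := v) (fun h => hyQ (h ▸ h3))
          (fun h => hy h.symm) Q' h1 h2 h3 hyQ
      exact this x (by simp [h4]) y (by simp)
  · by_contra hxy
    obtain ⟨Q', h1, h2, h3, h4⟩ := c1 x hx
    by_cases hyQ : y ∈ Q'
    · exact h2 v h3 y hyQ hy
    · have := star r hr w hw R hR hmax (u := y) (v := x) (fun h => hyQ (h ▸ h4))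
          (fun h => hxy h.symm) Q' h1 h2 h4 hyQ
      exact this v (by simp [h3]) y (by simp) hy

lemma esum {V : Type*} (w : V → ℕ) (hw : ∀ x, 0 < w x) (C : Finset V) :
    ∀ j, 1 ≤ j → j < C.card → ∑ c ∈ C, w c ≤ ∑ S ∈ powersetCard j C, ∏ i ∈ S, w i := by
  induction C using Finset.induction_on with
  | empty => intro j _ h; simp at h
  | insert c C hc ih =>
    intro j h1 h2
    obtain ⟨i, rfl⟩ : ∃ i, j = i + 1 := ⟨j - 1, by omega⟩
    rw [card_insert_of_notMem hc] at h2
    rcases Nat.eq_zero_or_pos i with rfl | hi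
    · exact le_of_eq (by rw [zero_add, powersetCard_one, sum_map]; simp)
    have hd : Disjoint (powersetCard (i + 1) C) ((powersetCard i C).image (insert c)) := by
      rw [disjoint_left]
      intro S hS hS'
      obtain ⟨T, _, rfl⟩ := mem_image.1 hS'
      exact hc ((mem_powersetCard.1 hS).1 (by simp))
    have hmem : ∀ T ∈ powersetCard i C, c ∉ T := fun T hT h => hc ((mem_powersetCard.1 hT).1 h)
    rw [sum_insert hc, show i + 1 = i.succ from rfl, powersetCard_succ_insert hc, sum_union hd,
      sum_image]
    · have e1 : ∑ T ∈ powersetCard i C, ∏ k ∈ insert c T, w k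
          = w c * ∑ T ∈ powersetCard i C, ∏ k ∈ T, w k := by
        rw [mul_sum]
        exact sum_congr rfl fun T hT => prod_insert (hmem T hT)
      rw [e1]
      have e2 := ih i hi (by omega)
      have e3 : 0 < ∑ T ∈ powersetCard (i + 1) C, ∏ k ∈ T, w k := by
        apply sum_pos
        · intro T _; exact prod_pos fun k _ => hw k
        · exact powersetCard_nonempty.2 (by omega)
      have e4 : 0 < ∑ c ∈ C, w c := by
        apply sum_pos
        · intro T _; exact hw _
        · exact card_pos.1 (by omega)
      have e5 := Nat.mul_le_mul_left (w c) e2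
      have e6 : w c + ∑ c ∈ C, w c ≤ w c * ∑ c ∈ C, w c + 1 := by
        have := hw c
        nlinarith
      omega
    · intro T hT T' hT' h
      have := congrArg (fun S => S.erase c) h
      simpa [erase_insert (hmem T hT), erase_insert (hmem T' hT')] using this

def del {V : Type*} (R : SimpleGraph V) (C : Finset V) : SimpleGraph V where
  Adj a b := R.Adj a b ∧ a ∉ C ∧ b ∉ C
  symm := ⟨fun _ _ h => ⟨h.1.symm, h.2.2, h.2.1⟩⟩
  loopless := ⟨fun _ h => R.irrefl h.1⟩

lemma recolor {V : Type*} [Fintype V] (r : ℕ) (hr : 3 ≤ r) (w : V → ℕ) (hw : ∀ x, 0 < w x)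
    (R : SimpleGraph V) (C : Finset V) (hC : Ind R C) (hC' : ∀ x ∈ C, ∀ y, y ∉ C → R.Adj x y)
    (hcard : r ≤ C.card) : PP (HH r R) w ≤ PP (HH r (del R C)) w := by
  unfold PP
  rw [← sum_sdiff_le_sum_sdiff]
  set X := univ.filter (HH r R)
  set Y := univ.filter (HH r (del R C))
  have hX : X \ Y ⊆ (C ×ˢ Cᶜ).image (fun p => ({p.1, p.2} : Finset V)) := by
    intro S hS
    simp only [X, Y, mem_sdiff, mem_filter, mem_univ, true_and] at hS
    obtain ⟨h1, h2⟩ := hS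
    rcases h1 with h1 | h1
    · obtain ⟨a, b, hab, rfl⟩ := card_eq_two.1 h1.1
      have hadj : R.Adj a b := h1.2 (by simp) (by simp) hab
      simp only [mem_image, mem_product, mem_compl, Prod.exists]
      by_cases ha : a ∈ C
      · exact ⟨a, b, ⟨ha, fun hb => hC a ha b hb hadj⟩, rfl⟩
      by_cases hb : b ∈ C
      · exact ⟨b, a, ⟨hb, ha⟩, pair_comm _ _⟩
      exfalso
      apply h2
      refine Or.inl ⟨h1.1, ?_⟩
      intro x hx y hy hxy
      refine ⟨h1.2 hx hy hxy, ?_, ?_⟩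
      · simp at hx; rcases hx with rfl | rfl <;> assumption
      · simp at hy; rcases hy with rfl | rfl <;> assumption
    · exact absurd (Or.inr ⟨h1.1, fun x hx y hy h => h1.2 x hx y hy h.1⟩) h2
  have hY : (powersetCard (r - 1) C ×ˢ Cᶜ).image (fun p => insert p.2 p.1) ⊆ Y \ X := by
    intro S hS
    simp only [mem_image, mem_product, mem_compl, Prod.exists, mem_powersetCard] at hS
    obtain ⟨T, z, ⟨⟨hT, hTc⟩, hz⟩, rfl⟩ := hS
    have hzT : z ∉ T := fun h => hz (hT h)
    have hcd : (insert z T).card = r := by rw [card_insert_of_notMem hzT]; omega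
    obtain ⟨c, hc⟩ : T.Nonempty := card_pos.1 (by omega)
    simp only [X, Y, mem_sdiff, mem_filter, mem_univ, true_and]
    constructor
    · refine Or.inr ⟨hcd, ?_⟩
      rw [ind_insert_iff]
      exact ⟨fun x hx y hy h => h.2.1 (hT hx), fun b hb h => h.2.2 (hT hb)⟩
    · rintro (h | h)
      · omega
      · exact h.2 c (by simp [hc]) z (by simp) (hC' c (hT hc) z hz)
  calc ∑ S ∈ X \ Y, ∏ i ∈ S, w i
      ≤ ∑ S ∈ (C ×ˢ Cᶜ).image (fun p => ({p.1, p.2} : Finset V)), ∏ i ∈ S, w i :=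
        sum_le_sum_of_subset hX
    _ = ∑ p ∈ C ×ˢ Cᶜ, w p.1 * w p.2 := by
        rw [sum_image]
        · refine sum_congr rfl fun p hp => ?_
          simp only [mem_product, mem_compl] at hp
          exact prod_pair fun h => hp.2 (h ▸ hp.1)
        · rintro ⟨a, b⟩ hp ⟨a', b'⟩ hp' h
          simp only [coe_product, Set.mem_prod, mem_coe, mem_compl] at hp hp'
          have h : ({a, b} : Finset V) = {a', b'} := h
          have h1 : a ∈ ({a', b'} : Finset V) := by rw [← h]; simp
          have h2 : b ∈ ({a', b'} : Finset V) := by rw [← h]; simp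
          simp only [mem_insert, mem_singleton] at h1 h2
          rcases h1 with rfl | rfl
          · rcases h2 with rfl | rfl
            · exact absurd hp.1 hp.2
            · rfl
          · exact absurd hp.1 hp'.2
    _ = (∑ c ∈ C, w c) * ∑ z ∈ Cᶜ, w z := by rw [sum_mul_sum, sum_product]
    _ ≤ (∑ S ∈ powersetCard (r - 1) C, ∏ i ∈ S, w i) * ∑ z ∈ Cᶜ, w z :=
        Nat.mul_le_mul_right _ (esum w hw C (r - 1) (by omega) (by omega))
    _ = ∑ p ∈ powersetCard (r - 1) C ×ˢ Cᶜ, (∏ i ∈ p.1, w i) * w p.2 := by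
        rw [sum_mul_sum, sum_product]
    _ = ∑ S ∈ (powersetCard (r - 1) C ×ˢ Cᶜ).image (fun p => insert p.2 p.1), ∏ i ∈ S, w i := by
        rw [sum_image]
        · refine sum_congr rfl fun p hp => ?_
          simp only [mem_product, mem_compl, mem_powersetCard] at hp
          rw [prod_insert fun h => hp.2 (hp.1.1 h), mul_comm]
        · rintro ⟨S, z⟩ hp ⟨S', z'⟩ hp' h
          simp only [coe_product, Set.mem_prod, mem_coe, mem_compl, mem_powersetCard] at hp hp'
          have h : insert z S = insert z' S' := h
          have hz : z = z' := by
            have : z ∈ insert z' S' := by rw [← h]; simp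
            rcases mem_insert.1 this with h | h
            · exact h
            · exact absurd (hp'.1.1 h) hp.2
          subst hz
          have h3 := congrArg (fun S => S.erase z) h
          simp only [erase_insert (fun h => hp.2 (hp.1.1 h)),
            erase_insert (fun h => hp.2 (hp'.1.1 h))] at h3
          rw [h3]
    _ ≤ ∑ S ∈ Y \ X, ∏ i ∈ S, w i := sum_le_sum_of_subset hY

lemma coloring {V : Type*} [Fintype V] (r : ℕ) (hr : 3 ≤ r) (w : V → ℕ) (hw : ∀ x, 0 < w x)
    (R0 : SimpleGraph V) (hR0 : R0.CliqueFree r) :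
    PP (HH r R0) w ≤ PP (fun S => S.card = r) w ∨
    ∃ R : SimpleGraph V, R.CliqueFree r ∧
      PP (HH r R0) w ≤ PP (fun S => S.card = 2 ∧ R.IsClique S) w := by
  obtain ⟨R, hR, hmax⟩ := Set.exists_max_image {R : SimpleGraph V | R.CliqueFree r}
    (fun R => PP (HH r R) w) (Set.toFinite _) ⟨R0, hR0⟩
  have hR : R.CliqueFree r := hR
  have hmax : ∀ R' : SimpleGraph V, R'.CliqueFree r → PP (HH r R') w ≤ PP (HH r R) w := hmax
  by_cases hQ : ∃ Q : Finset V, Q.card = r ∧ Ind R Q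
  · left
    obtain ⟨Q, hQ, hQI⟩ := hQ
    obtain ⟨v, hv⟩ : Q.Nonempty := card_pos.1 (by omega)
    obtain ⟨c1, c2⟩ := component r hr w hw R hR hmax Q hQ hQI v hv
    set C := univ.filter (fun x => ¬ R.Adj v x) with hCdef
    have hmC : ∀ x, x ∈ C ↔ ¬ R.Adj v x := fun x => by simp [hCdef]
    have hvC : v ∈ C := by simp [hmC]
    have hrec := recolor r hr w hw R C
      (fun x hx y hy => c1 x y ((hmC x).1 hx) ((hmC y).1 hy))
      (fun x hx y hy => c2 x y ((hmC x).1 hx) (by rw [hmC] at hy; simpa using hy))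
      (hQ ▸ card_le_card fun x hx => (hmC x).2 (hQI v hv x hx))
    have hle : del R C ≤ R := fun a b h => h.1
    have hR1 : (del R C).CliqueFree r := hR.anti hle
    obtain ⟨d1, _⟩ := component r hr w hw (del R C) hR1
      (fun R' h => (hmax R' h).trans hrec) Q hQ (fun x hx y hy h => hQI x hx y hy h.1) v hv
    have hno : ∀ x y, ¬ (del R C).Adj x y :=
      fun x y => d1 x y (fun h => h.2.1 hvC) (fun h => h.2.1 hvC)
    refine (hmax R0 hR0).trans (hrec.trans (PP_le w ?_))
    rintro S (h | h)
    · obtain ⟨a, b, hab, rfl⟩ := card_eq_two.1 h.1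
      exact absurd (h.2 (by simp) (by simp) hab) (hno a b)
    · exact h.1
  · right
    refine ⟨R, hR, (hmax R0 hR0).trans (PP_le w ?_)⟩
    rintro S (h | h)
    · exact h
    · exact absurd ⟨S, h⟩ hQ

end RB

namespace RB
open Finset

lemma support_card {V : Type*} [Fintype V] (G : SimpleGraph V) (k : ℕ) (hG : G.CliqueFree k)
    (w : V → ℕ) (hw : G.IsClique {x | w x ≠ 0}) :
    (univ.filter (fun x => w x ≠ 0)).card < k := by
  by_contra h
  push Not at h
  have : ¬ G.CliqueFree (univ.filter (fun x => w x ≠ 0)).card := by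
    apply SimpleGraph.IsNClique.not_cliqueFree (s := univ.filter (fun x => w x ≠ 0))
    exact ⟨by simpa using hw, rfl⟩
  exact this (hG.mono h)

lemma edge_bound {V : Type*} [Fintype V] (r n : ℕ) (hr : 2 ≤ r) (R : SimpleGraph V)
    (hR : R.CliqueFree r) (w : V → ℕ) (hn : ∑ x, w x = n) :
    PP (fun S => S.card = 2 ∧ R.IsClique S) w
      ≤ edgeCount (SimpleGraph.turanGraph n (r - 1)) := by
  obtain ⟨w', h1, h2, h3⟩ := zykov R (fun S => S.card = 2 ∧ R.IsClique S) (fun S h => h.2) _ w le_rfl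
  have h4 := support_card R r hR w' h3
  rw [edgeCount_eq]
  refine h2.trans ((PP_le w' fun S h => h.1).trans
    (esymm_le_turan 2 (r - 1) n (by omega) w' (by omega) (h1.trans hn)))

theorem main (r k n : ℕ) (hr : 2 ≤ r) (hk : r < k)
    (R B : SimpleGraph (Fin n)) (hdisj : Disjoint R B)
    (hKk : (R ⊔ B).CliqueFree k) (hKr : R.CliqueFree r) :
    edgeCount R + cliqueCount r B ≤
      max (edgeCount (SimpleGraph.turanGraph n (r - 1)))
        (cliqueCount r (SimpleGraph.turanGraph n (k - 1))) := by
  have hRB : ∀ a b, R.Adj a b → ¬ B.Adj a b := fun a b h1 h2 =>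
    (disjoint_iff_inf_le.1 hdisj : R ⊓ B ≤ ⊥) (show (R ⊓ B).Adj a b from ⟨h1, h2⟩)
  let H : Finset (Fin n) → Prop := fun S => R.IsNClique 2 S ∨ B.IsNClique r S
  have h0 : edgeCount R + cliqueCount r B = PP H (fun _ => 1) := by
    rw [edgeCount_eq, cliqueCount_eq, cliqueCount_eq]
    unfold PP
    simp only [prod_const_one, sum_const, smul_eq_mul, mul_one]
    rw [← card_union_of_disjoint]
    · refine congrArg Finset.card ?_
      ext S
      simp [H]
    · rw [disjoint_left]
      intro S h1 h2
      simp only [mem_filter, mem_univ, true_and] at h1 h2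
      obtain ⟨a, b, hab, rfl⟩ := card_eq_two.1 h1.card_eq
      exact hRB a b (h1.isClique (by simp) (by simp) hab) (h2.isClique (by simp) (by simp) hab)
  obtain ⟨w, h1, h2, h3⟩ := zykov (R ⊔ B) H (by
    rintro S (h | h)
    · exact h.isClique.mono le_sup_left
    · exact h.isClique.mono le_sup_right) _ (fun _ => 1) le_rfl
  have h4 := support_card _ k hKk w h3
  have hsum : ∑ x, w x = n := by rw [h1]; simp
  rw [h0]
  refine h2.trans ?_
  rcases Nat.lt_or_ge r 3 with hr3 | hr3
  · have : r = 2 := by omega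
    subst this
    refine le_max_of_le_right ?_
    refine (PP_le w (H' := fun S => S.card = 2) ?_).trans
      (esymm_le_turan 2 (k - 1) n (by omega) w (by omega) hsum)
    rintro S (h | h) <;> exact h.card_eq
  · let K := {x // w x ≠ 0}
    let e : K ↪ Fin n := Function.Embedding.subtype _
    have e1 := PP_embed e H w (fun x hx => ⟨⟨x, hx⟩, rfl⟩)
    have hsumK : ∑ u : K, w (e u) = n := by
      refine Eq.trans ?_ hsum
      rw [← sum_map univ e w]
      apply sum_subset (subset_univ _)
      intro x _ hx
      by_contra hne
      exact hx (mem_map.2 ⟨⟨x, hne⟩, mem_univ _, rfl⟩)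
    let RK : SimpleGraph K := R.comap e
    have hRK : RK.CliqueFree r := by
      intro S hS
      apply hKr (S.map e)
      refine ⟨?_, by rw [card_map, hS.card_eq]⟩
      intro x hx y hy hxy
      simp only [coe_map, Set.mem_image] at hx hy
      obtain ⟨a, ha, rfl⟩ := hx
      obtain ⟨b, hb, rfl⟩ := hy
      exact hS.isClique ha hb (fun h => hxy (h ▸ rfl))
    have hle : PP H w ≤ PP (HH r RK) (fun u => w (e u)) := by
      rw [e1]
      apply PP_le
      rintro S (h | h)
      · refine Or.inl ⟨by simpa using h.card_eq, ?_⟩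
        intro x hx y hy hxy
        exact h.isClique (by simpa using hx) (by simpa using hy) (fun h => hxy (e.injective h))
      · refine Or.inr ⟨by simpa using h.card_eq, ?_⟩
        intro x hx y hy hadj
        have hadj : R.Adj (e x) (e y) := hadj
        exact hRB _ _ hadj (h.isClique (by simpa using hx) (by simpa using hy) hadj.ne)
    refine hle.trans ?_
    rcases coloring r hr3 (fun u : K => w (e u)) (fun u => Nat.pos_of_ne_zero u.2) RK hRK with h | h
    · refine le_max_of_le_right (h.trans (esymm_le_turan r (k - 1) n (by omega) _ ?_ hsumK))
      have : (univ.filter (fun u : K => w (e u) ≠ 0)).card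
          ≤ (univ.filter (fun x => w x ≠ 0)).card := by
        apply card_le_card_of_injOn e
        · intro u _
          exact mem_coe.2 (mem_filter.2 ⟨mem_univ _, u.2⟩)
        · exact e.injective.injOn
      omega
    · obtain ⟨R', hR', h⟩ := h
      exact le_max_of_le_left (h.trans (edge_bound r n hr R' hR' _ hsumK))

end RB


/-- Let `2 ≤ r < k`. For every red-blue `K_k`-free graph on `n` vertices whose
red part is `K_r`-free, `|E(G_red)| + N(K_r, G_blue)` is at most the maximum of the number of
edges of `T(n, r-1)` and the number of copies of `K_r` in `T(n, k-1)`. -/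
theorem red_blue_bound_turan (r k n : ℕ) (hr : 2 ≤ r) (hk : r < k) (hn : 0 < n)
    (R B : SimpleGraph (Fin n)) (hdisj : Disjoint R B)
    (hKk : (R ⊔ B).CliqueFree k) (hKr : R.CliqueFree r) :
    edgeCount R + cliqueCount r B ≤
      max (edgeCount (SimpleGraph.turanGraph n (r - 1)))
        (cliqueCount r (SimpleGraph.turanGraph n (k - 1))) := by
  exact RB.main r k n hr hk R B hdisj hKk hKr
end

section
/- For every integer k > 1 and every n, ex_3(n, Berge-C_{2k+1}) ≤ ((8k−8)/3) · ex(n, C_{2k}) + ex_3^{lin}(n, Berge-C_{2k+1}). -/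
open scoped Classical

theorem berge_of_cycle {V : Type*} (N : ℕ) (hN : 3 ≤ N) (H : Finset (Finset V))
    (x : ℕ → V) (g : ℕ → Finset V)
    (hx : ∀ i < N, ∀ j < N, x i = x j → i = j) (hg : ∀ i < N, ∀ j < N, g i = g j → i = j)
    (hH : ∀ i < N, g i ∈ H) (h1 : ∀ i < N, x i ∈ g i) (h2 : ∀ i, i + 1 < N → x (i + 1) ∈ g i)
    (h3 : x 0 ∈ g (N - 1)) : HasBergeCopy (SimpleGraph.cycleGraph N) H := by
  have key : ∀ e : (SimpleGraph.cycleGraph N).edgeSet, ∃ i : Fin N, ∃ j : Fin N,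
      (e : Sym2 (Fin N)) = s(i, j) ∧ ((i : ℕ) + 1 = j ∨ ((i : ℕ) = N - 1 ∧ (j : ℕ) = 0)) := by
    rintro ⟨e, he⟩
    induction e using Sym2.ind with
    | _ a b =>
      rw [SimpleGraph.mem_edgeSet, SimpleGraph.cycleGraph_adj'] at he
      have aux : ∀ a b : Fin N, (a - b).val = 1 →
          ((b : ℕ) + 1 = a ∨ ((b : ℕ) = N - 1 ∧ (a : ℕ) = 0)) := by
        intro a b h
        have ha := a.2
        have hb := b.2
        rcases le_or_gt b a with hab | hab
        · rw [Fin.sub_val_of_le hab] at h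
          have : (b : ℕ) ≤ a := hab
          omega
        · rw [Fin.coe_sub_iff_lt.2 hab] at h
          have : (a : ℕ) < b := hab
          omega
      rcases he with he | he
      · exact ⟨b, a, Sym2.eq_swap, aux _ _ he⟩
      · exact ⟨a, b, rfl, aux _ _ he⟩
  choose I J hIJ hIJ2 using key
  refine ⟨⟨fun i => x i, fun i j h => Fin.ext (hx _ i.2 _ j.2 h)⟩, fun e => g (I e), ?_, ?_⟩
  · intro e e' h
    have h' : (I e : ℕ) = I e' := hg _ (I e).2 _ (I e').2 h
    have h'' : (J e : ℕ) = J e' := by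
      have := hIJ2 e
      have := hIJ2 e'
      have := (J e).2
      have := (J e').2
      omega
    apply Subtype.ext
    rw [hIJ, hIJ, Fin.ext h', Fin.ext h'']
  · intro e
    refine ⟨hH _ (I e).2, ?_⟩
    intro y hy
    rw [hIJ, Sym2.mem_iff] at hy
    rcases hy with rfl | rfl
    · exact h1 _ (I e).2
    · rcases hIJ2 e with h | ⟨h, h'⟩
      · have := h2 (I e) (by rw [h]; exact (J e).2)
        rw [h] at this
        exact this
      · show x (J e) ∈ g (I e)
        rw [h, h']
        exact h3

/-- A Berge path `x 0, ..., x m` with hyperedges `g i`, with an active closing pair. -/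
def St {V : Type*} (H1 H' : Finset (Finset V)) (w : Finset V → V) (m : ℕ) (x : ℕ → V)
    (g : ℕ → Finset V) (e : Finset V) : Prop :=
  (∀ i ≤ m, ∀ j ≤ m, x i = x j → i = j) ∧ (∀ i < m, ∀ j < m, g i = g j → i = j) ∧
  (∀ i < m, x i ∈ g i ∧ x (i + 1) ∈ g i) ∧
  (∀ i < m, g i ∈ H1 ∨ (g i ∈ H' ∧ ∀ y ∈ g i, ∃ j ≤ m, y = x j)) ∧
  e ∈ H' ∧ x 0 ∈ e ∧ x m ∈ e ∧ (w e = x 0 ∨ w e = x m) ∧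
  ∀ i < m, g i ∈ H' → x 0 ∈ g i → x m ∈ g i → g i = e

theorem St.rev {V : Type*} {H1 H' : Finset (Finset V)} {w : Finset V → V} {m : ℕ} {x : ℕ → V}
    {g : ℕ → Finset V} {e : Finset V} (h : St H1 H' w m x g e) :
    St H1 H' w m (fun i => x (m - i)) (fun i => g (m - 1 - i)) e := by
  obtain ⟨a1, a2, a3, a4, a5, a6, a7, a8, a9⟩ := h
  refine ⟨?_, ?_, ?_, ?_, a5, by simpa using a7, by simpa using a6, by simpa using a8.symm, ?_⟩
  · intro i hi j hj h
    have := a1 _ (by omega) _ (by omega) h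
    omega
  · intro i hi j hj h
    have := a2 _ (by omega) _ (by omega) h
    omega
  · intro i hi
    have := a3 (m - 1 - i) (by omega)
    rw [show m - 1 - i + 1 = m - i by omega] at this
    exact ⟨this.2, by simp only []; rw [show m - (i + 1) = m - 1 - i by omega]; exact this.1⟩
  · intro i hi
    rcases a4 (m - 1 - i) (by omega) with h | ⟨h, h'⟩
    · exact Or.inl h
    · refine Or.inr ⟨h, fun y hy => ?_⟩
      obtain ⟨j, hj, rfl⟩ := h' y hy
      exact ⟨m - j, by omega, by simp only []; congr 1; omega⟩
  · intro i hi hH h0 hm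
    exact a9 _ (by omega) hH (by simpa using hm) (by simpa using h0)

theorem St.step {V : Type*} [DecidableEq V] {H1 H' : Finset (Finset V)} {w : Finset V → V}
    {m : ℕ} {x : ℕ → V} {g : ℕ → Finset V} {e : Finset V} (hm : 1 ≤ m)
    (hdis : ∀ e ∈ H', e ∉ H1) (h3 : ∀ e ∈ H', e.card = 3)
    (h : St H1 H' w m x g e) (e' : Finset V) (z : V) (he' : e' ∈ H') (hz : z ∈ e')
    (hzx : ∀ j ≤ m, z ≠ x j) (h0 : x 0 ∈ e') (hxm : x m ∈ e') (hw : w e' = x 0 ∨ w e' = x m) :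
    ∃ x' g', St H1 H' w (m + 1) x' g' e' := by
  have main : ∀ (x : ℕ → V) (g : ℕ → Finset V), St H1 H' w m x g e → 
      (∀ j ≤ m, z ≠ x j) → x 0 ∈ e' → x m ∈ e' → w e' = x 0 → 
      ∃ x' g', St H1 H' w (m + 1) x' g' e' := by
    clear h hzx h0 hxm hw
    intro x g h hzx h0 hxm hw
    obtain ⟨a1, a2, a3, a4, a5, a6, a7, a8, a9⟩ := h
    have hne : x 0 ≠ x m := fun h => by
      have := a1 _ (by omega) _ le_rfl h
      omega
    have hsub : ({x 0, x m, z} : Finset V) = e' := by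
      apply Finset.eq_of_subset_of_card_le
      · intro y hy
        simp only [Finset.mem_insert, Finset.mem_singleton] at hy
        rcases hy with rfl | rfl | rfl <;> assumption
      · rw [h3 _ he', Finset.card_eq_three.2 ⟨x 0, x m, z, hne, (hzx 0 (by omega)).symm,
          (hzx m le_rfl).symm, rfl⟩]
    have hnew : ∀ i < m, g i ∈ H' → z ∉ g i := by
      intro i hi hH hzi
      rcases a4 i hi with h | ⟨-, h⟩
      · exact hdis _ hH h
      · obtain ⟨j, hj, rfl⟩ := h _ hzi
        exact hzx j hj rfl
    have hge : ∀ i < m, g i ≠ e' := by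
      intro i hi h
      exact hnew i hi (h ▸ he') (h ▸ hz)
    refine ⟨fun i => if i ≤ m then x i else z, fun i => if i < m then g i else e', ?_, ?_, ?_, ?_,
      he', ?_, ?_, ?_, ?_⟩
    · intro i hi j hj hij
      simp only [] at hij
      split_ifs at hij with b1 b2 b2
      · exact a1 _ b1 _ b2 hij
      · exact absurd hij.symm (hzx _ b1)
      · exact absurd hij (hzx _ b2)
      · omega
    · intro i hi j hj hij
      simp only [] at hij
      split_ifs at hij with b1 b2 b2
      · exact a2 _ b1 _ b2 hij
      · exact absurd hij (hge _ b1)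
      · exact absurd hij.symm (hge _ b2)
      · omega
    · intro i hi
      by_cases b : i < m
      · simp only [b, b.le, if_true, Nat.succ_le_iff.2 b]
        exact a3 i b
      · have : i = m := by omega
        subst this
        simpa using ⟨hxm, hz⟩
    · intro i hi
      by_cases b : i < m
      · simp only [b, if_true]
        rcases a4 i b with h | ⟨h, h'⟩
        · exact Or.inl h
        · refine Or.inr ⟨h, fun y hy => ?_⟩
          obtain ⟨j, hj, rfl⟩ := h' y hy
          exact ⟨j, by omega, by simp [hj]⟩
      · simp only [b, if_false]
        refine Or.inr ⟨he', fun y hy => ?_⟩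
        rw [← hsub] at hy
        simp only [Finset.mem_insert, Finset.mem_singleton] at hy
        rcases hy with rfl | rfl | rfl
        · exact ⟨0, by omega, by simp⟩
        · exact ⟨m, by omega, by simp⟩
        · exact ⟨m + 1, by omega, by simp⟩
    · simpa using h0
    · simpa using hz
    · simpa using Or.inl hw
    · intro i hi
      by_cases b : i < m
      · simp only [b, if_true]
        intro hH _ hz'
        simp at hz'
        exact absurd hz' (hnew i b hH)
      · simp [b]
  rcases hw with hw | hw
  · exact main x g h hzx h0 hxm hw
  · refine main _ _ h.rev ?_ (by simpa using hxm) (by simpa using h0) (by simpa using hw)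
    intro j hj
    exact hzx _ (by omega)

theorem exists_low {V : Type*} [DecidableEq V] {H H1 H' : Finset (Finset V)} {w : Finset V → V}
    {hh : Finset V → Finset V} {k : ℕ} (hk : 2 ≤ k)
    (hH1 : ∀ e ∈ H1, e ∈ H) (hH' : ∀ e ∈ H', e ∈ H) (hdis : ∀ e ∈ H', e ∉ H1)
    (h3 : ∀ e ∈ H', e.card = 3) (hw : ∀ e ∈ H', w e ∈ e ∧ hh e ∈ H1 ∧ e.erase (w e) ⊆ hh e)
    (hne : H'.Nonempty) (hfree : ¬ HasBergeCopy (SimpleGraph.cycleGraph (2 * k + 1)) H) :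
    ∃ q : Finset V, q.card = 2 ∧ (H'.filter (fun e => q ⊆ e ∧ w e ∈ q)).Nonempty ∧
      (H'.filter (fun e => q ⊆ e ∧ w e ∈ q)).card ≤ 2 * k - 2 := by
  by_contra hcon
  push Not at hcon
  have grow : ∀ m, 2 ≤ m → m ≤ 2 * k → ∃ x g e, St H1 H' w m x g e := by
    intro m hm
    induction m, hm using Nat.le_induction with
    | base =>
      intro _
      obtain ⟨e, he⟩ := hne
      obtain ⟨b1, b2, b3⟩ := hw e he
      have hc : (e.erase (w e)).card = 2 := by rw [Finset.card_erase_of_mem b1, h3 e he]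
      obtain ⟨u, v, huv, hE⟩ := Finset.card_eq_two.1 hc
      have hu : u ∈ e.erase (w e) := by rw [hE]; simp
      have hv : v ∈ e.erase (w e) := by rw [hE]; simp
      have hu' := Finset.mem_erase.1 hu
      have hv' := Finset.mem_erase.1 hv
      have hhe : hh e ≠ e := fun h => hdis e he (h ▸ b2)
      have hhe' : hh e ∉ H' := fun h => hdis _ h b2
      refine ⟨fun i => if i = 0 then u else if i = 1 then v else w e,
        fun i => if i = 0 then hh e else e, e, ?_, ?_, ?_, ?_, he, ?_, ?_, ?_, ?_⟩
      · intro i hi j hj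
        have n1 := hu'.1
        have n2 := hv'.1
        interval_cases i <;> interval_cases j <;> simp [huv, huv.symm, n1, n2, n1.symm, n2.symm]
      · intro i hi j hj
        interval_cases i <;> interval_cases j <;> simp [hhe, hhe.symm]
      · intro i hi
        interval_cases i
        · simpa using ⟨b3 hu, b3 hv⟩
        · simpa using ⟨hv'.2, b1⟩
      · intro i hi
        interval_cases i
        · exact Or.inl (by simpa using b2)
        · refine Or.inr ⟨by simpa using he, ?_⟩
          intro y hy
          simp at hy
          by_cases hyw : y = w e
          · exact ⟨2, le_rfl, by simp [hyw]⟩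
          · have : y ∈ e.erase (w e) := Finset.mem_erase.2 ⟨hyw, hy⟩
            rw [hE] at this
            simp at this
            rcases this with rfl | rfl
            · exact ⟨0, by omega, by simp⟩
            · exact ⟨1, by omega, by simp⟩
      · simpa using hu'.2
      · simpa using b1
      · simp
      · intro i hi
        interval_cases i
        · simp [hhe']
        · simp
    | succ m hm ih =>
      intro hmk
      obtain ⟨x, g, e, hS⟩ := ih (by omega)
      have hS' := hS
      obtain ⟨a1, a2, a3, a4, a5, a6, a7, a8, a9⟩ := hS'
      have hnex : x 0 ≠ x m := fun h => by
        have := a1 _ (by omega) _ le_rfl h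
        omega
      have hq := hcon {x 0, x m} (Finset.card_pair hnex) ⟨e, by
        simp only [Finset.mem_filter, Finset.insert_subset_iff, Finset.singleton_subset_iff,
          Finset.mem_insert, Finset.mem_singleton]
        exact ⟨a5, ⟨a6, a7⟩, a8⟩⟩
      set X := (Finset.range (m + 1)).image x with hX
      have hex : ∃ e' ∈ H'.filter (fun e => {x 0, x m} ⊆ e ∧ w e ∈ ({x 0, x m} : Finset V)),
          ¬ e' ⊆ X := by
        by_contra hall
        push Not at hall
        have hXc : (X \ {x 0, x m}).card ≤ 2 * k - 2 := by
          have hsub : ({x 0, x m} : Finset V) ⊆ X := by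
            simp only [Finset.insert_subset_iff, Finset.singleton_subset_iff, hX,
              Finset.mem_image, Finset.mem_range]
            exact ⟨⟨0, by omega, rfl⟩, ⟨m, by omega, rfl⟩⟩
          rw [Finset.card_sdiff_of_subset hsub, Finset.card_pair hnex]
          have : X.card ≤ m + 1 := by
            simpa using Finset.card_image_le (s := Finset.range (m + 1)) (f := x)
          omega
        have hle : (H'.filter (fun e => {x 0, x m} ⊆ e ∧ w e ∈ ({x 0, x m} : Finset V))).card
            ≤ ((X \ {x 0, x m}).powersetCard 1).card := by
          apply Finset.card_le_card_of_injOn (fun e => e \ {x 0, x m})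
          · intro e' he'
            have he'' := hall e' he'
            simp only [Finset.coe_filter, Set.mem_ofPred_eq] at he'
            simp only [Finset.mem_coe, Finset.mem_powersetCard]
            refine ⟨Finset.sdiff_subset_sdiff he'' le_rfl, ?_⟩
            rw [Finset.card_sdiff_of_subset he'.2.1, Finset.card_pair hnex, h3 _ he'.1]
          · intro e1 he1 e2 he2 h12
            simp only [Finset.coe_filter, Set.mem_ofPred_eq] at he1 he2
            simp only [] at h12
            rw [← Finset.sdiff_union_of_subset he1.2.1, h12,
              Finset.sdiff_union_of_subset he2.2.1]
        rw [Finset.card_powersetCard, Nat.choose_one_right] at hle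
        omega
      obtain ⟨e', he', hnot⟩ := hex
      simp only [Finset.mem_filter, Finset.insert_subset_iff, Finset.singleton_subset_iff,
          Finset.mem_insert, Finset.mem_singleton] at he'
      obtain ⟨z, hz, hzX⟩ := Finset.not_subset.1 hnot
      obtain ⟨x', g', h'⟩ := hS.step (by omega) hdis h3 e' z he'.1 hz (by
        intro j hj h
        apply hzX
        rw [hX, Finset.mem_image]
        exact ⟨j, by simpa using by omega, h.symm⟩) he'.2.1.1 he'.2.1.2 he'.2.2
      exact ⟨x', g', e', h'⟩
  obtain ⟨x, g, e, a1, a2, a3, a4, a5, a6, a7, a8, a9⟩ := grow (2 * k) (by omega) le_rfl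
  have hnex : x 0 ≠ x (2 * k) := fun h => by
    have := a1 _ (by omega) _ le_rfl h
    omega
  have hq := hcon {x 0, x (2 * k)} (Finset.card_pair hnex) ⟨e, by
    simp only [Finset.mem_filter, Finset.insert_subset_iff, Finset.singleton_subset_iff,
      Finset.mem_insert, Finset.mem_singleton]
    exact ⟨a5, ⟨a6, a7⟩, a8⟩⟩
  obtain ⟨e', he', hee'⟩ := Finset.exists_mem_ne (lt_of_le_of_lt (show 1 ≤ 2 * k - 2 by omega) hq) e
  simp only [Finset.mem_filter, Finset.insert_subset_iff, Finset.singleton_subset_iff,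
          Finset.mem_insert, Finset.mem_singleton] at he'
  have hge : ∀ i < 2 * k, g i ≠ e' := by
    intro i hi h
    subst h
    exact hee' (a9 i hi he'.1 he'.2.1.1 he'.2.1.2)
  apply hfree
  apply berge_of_cycle _ (by omega) _ x (fun i => if i < 2 * k then g i else e')
  · intro i hi j hj
    exact a1 i (by omega) j (by omega)
  · intro i hi j hj hij
    split_ifs at hij with b1 b2 b2
    · exact a2 _ b1 _ b2 hij
    · exact absurd hij (hge _ b1)
    · exact absurd hij.symm (hge _ b2)
    · omega
  · intro i hi
    split_ifs with b
    · rcases a4 i b with h | h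
      · exact hH1 _ h
      · exact hH' _ h.1
    · exact hH' _ he'.1
  · intro i hi
    split_ifs with b
    · exact (a3 i b).1
    · have : i = 2 * k := by omega
      rw [this]
      exact he'.2.1.2
  · intro i hi
    have b : i < 2 * k := by omega
    simp only [b, if_true]
    exact (a3 i b).2
  · simp [he'.2.1.1]

theorem exists_assign {V : Type*} [DecidableEq V] {H H1 : Finset (Finset V)} {w : Finset V → V}
    {hh : Finset V → Finset V} {k : ℕ} (hk : 2 ≤ k)
    (hH1 : ∀ e ∈ H1, e ∈ H)
    (hfree : ¬ HasBergeCopy (SimpleGraph.cycleGraph (2 * k + 1)) H) (H' : Finset (Finset V))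
    (hH' : ∀ e ∈ H', e ∈ H) (hdis : ∀ e ∈ H', e ∉ H1)
    (h3 : ∀ e ∈ H', e.card = 3) (hw : ∀ e ∈ H', w e ∈ e ∧ hh e ∈ H1 ∧ e.erase (w e) ⊆ hh e) :
    ∃ p : Finset V → Finset V, (∀ e ∈ H', p e ⊆ e ∧ (p e).card = 2 ∧ w e ∈ p e) ∧
      ∀ q, (H'.filter (fun e => p e = q)).card ≤ 2 * k - 2 := by
  induction H' using Finset.strongInduction with
  | H H' ih =>
    rcases H'.eq_empty_or_nonempty with rfl | hne
    · exact ⟨id, by simp, by simp⟩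
    obtain ⟨q, hq2, hqne, hq⟩ := exists_low hk hH1 hH' hdis h3 hw hne hfree
    set D := H'.filter (fun e => q ⊆ e ∧ w e ∈ q) with hD
    have hDs : D ⊆ H' := Finset.filter_subset _ _
    have hsub : ∀ e ∈ H' \ D, e ∈ H' := fun e he => (Finset.mem_sdiff.1 he).1
    obtain ⟨p, hp1, hp2⟩ := ih (H' \ D) (Finset.sdiff_ssubset hDs hqne)
      (fun e he => hH' e (hsub e he)) (fun e he => hdis e (hsub e he))
      (fun e he => h3 e (hsub e he)) (fun e he => hw e (hsub e he))
    refine ⟨fun e => if e ∈ D then q else p e, ?_, ?_⟩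
    · intro e he
      by_cases heD : e ∈ D
      · simp only [heD, if_true]
        have := (Finset.mem_filter.1 heD).2
        exact ⟨this.1, hq2, this.2⟩
      · simp only [heD, if_false]
        exact hp1 e (Finset.mem_sdiff.2 ⟨he, heD⟩)
    · intro r
      by_cases hr : r = q
      · subst hr
        refine le_trans (Finset.card_le_card ?_) hq
        intro e he
        obtain ⟨he1, he2⟩ := Finset.mem_filter.1 he
        by_contra heD
        simp only [heD, if_false] at he2
        obtain ⟨c1, c2, c3⟩ := hp1 e (Finset.mem_sdiff.2 ⟨he1, heD⟩)
        rw [he2] at c1 c3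
        exact heD (Finset.mem_filter.2 ⟨he1, c1, c3⟩)
      · refine le_trans (Finset.card_le_card ?_) (hp2 r)
        intro e he
        obtain ⟨he1, he2⟩ := Finset.mem_filter.1 he
        by_cases heD : e ∈ D
        · simp only [heD, if_true] at he2
          exact absurd he2.symm hr
        · simp only [heD, if_false] at he2
          exact Finset.mem_filter.2 ⟨Finset.mem_sdiff.2 ⟨he1, heD⟩, he2⟩



theorem cycle_seq {V : Type*} {G : SimpleGraph V} {N : ℕ} (hN : 3 ≤ N)
    (h : HasCopy (SimpleGraph.cycleGraph N) G) :
    ∃ y : ℕ → V, (∀ i j, y i = y j ↔ i ≡ j [MOD N]) ∧ ∀ i, G.Adj (y i) (y (i + 1)) := by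
  obtain ⟨φ, hφ⟩ := h
  have hpos : 0 < N := by omega
  refine ⟨fun i => φ ⟨i % N, Nat.mod_lt _ hpos⟩, ?_, ?_⟩
  · intro i j
    simp [Nat.ModEq]
  · intro i
    apply hφ
    rw [SimpleGraph.cycleGraph_adj']
    right
    have h1 := Nat.mod_lt i hpos
    simp only [Fin.sub_def, Fin.val_mk]
    rcases Nat.lt_or_ge (i % N + 1) N with h2 | h2
    · have : (i + 1) % N = i % N + 1 := by
        rw [Nat.add_mod, Nat.mod_eq_of_lt (show 1 < N by omega), Nat.mod_eq_of_lt h2]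
      rw [this, show N - i % N + (i % N + 1) = 1 + N by omega, Nat.add_mod_right,
        Nat.mod_eq_of_lt (by omega)]
    · have : (i + 1) % N = 0 := by
        rw [Nat.add_mod, Nat.mod_eq_of_lt (show 1 < N by omega), show i % N + 1 = N by omega,
          Nat.mod_self]
      rw [this, show N - i % N + 0 = 1 by omega, Nat.mod_eq_of_lt (by omega)]

theorem modEq_small {N s i j : ℕ} (hi : i < N) (hj : j < N) (h : s + i ≡ s + j [MOD N]) :
    i = j := by
  have := Nat.ModEq.add_left_cancel' s h
  rwa [Nat.ModEq, Nat.mod_eq_of_lt hi, Nat.mod_eq_of_lt hj] at this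

theorem pair_modEq {V : Type*} [DecidableEq V] {N : ℕ} (hN : 3 ≤ N) {y : ℕ → V}
    (hy : ∀ i j, y i = y j ↔ i ≡ j [MOD N]) {a b : ℕ}
    (h : ({y a, y (a + 1)} : Finset V) = {y b, y (b + 1)}) : a ≡ b [MOD N] := by
  have h1 : y a ∈ ({y b, y (b + 1)} : Finset V) := by rw [← h]; simp
  have h2 : y (a + 1) ∈ ({y b, y (b + 1)} : Finset V) := by rw [← h]; simp
  simp only [Finset.mem_insert, Finset.mem_singleton, hy] at h1 h2
  rcases h1 with h1 | h1
  · exact h1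
  rcases h2 with h2 | h2
  · exfalso
    have h3 : a + 2 ≡ a + 0 [MOD N] := (h2.add_right 1).trans h1.symm
    have := modEq_small (by omega) (by omega) h3
    omega
  · exact Nat.ModEq.add_right_cancel' 1 h2

theorem third_in_cycle {V : Type*} [DecidableEq V] {H H1 H2 : Finset (Finset V)}
    {w : Finset V → V}
    {hh p : Finset V → Finset V} {k : ℕ} (hk : 2 ≤ k)
    (hH1 : ∀ e ∈ H1, e ∈ H)
    (hfree : ¬ HasBergeCopy (SimpleGraph.cycleGraph (2 * k + 1)) H)
    (hH2 : ∀ e ∈ H2, e ∈ H) (hdis : ∀ e ∈ H2, e ∉ H1)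
    (hw : ∀ e ∈ H2, w e ∈ e ∧ hh e ∈ H1 ∧ e.erase (w e) ⊆ hh e)
    (hp : ∀ e ∈ H2, p e ⊆ e ∧ (p e).card = 2 ∧ w e ∈ p e)
    {y : ℕ → V} (hy : ∀ i j, y i = y j ↔ i ≡ j [MOD 2 * k])
    {E : ℕ → Finset V} (hE : ∀ i, E i ∈ H2 ∧ p (E i) = {y i, y (i + 1)})
    (j : ℕ) (e : Finset V) (he : e ∈ H2) (hpe : p e = {y j, y (j + 1)}) :
    ∀ v ∈ e, ∃ i < 2 * k, v = y i := by
  intro v hv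
  by_contra hno
  have hno' : ∀ i, v ≠ y i := by
    intro i h
    apply hno
    refine ⟨i % (2 * k), Nat.mod_lt _ (by omega), h.trans ((hy _ _).2 (Nat.mod_modEq _ _).symm)⟩
  obtain ⟨b1, b2, b3⟩ := hw e he
  obtain ⟨c1, c2, c3⟩ := hp e he
  have hlast : y (j + 1 + (2 * k - 1)) = y j := by
    rw [hy, show j + 1 + (2 * k - 1) = j + 2 * k by omega]
    simp [Nat.ModEq]
  have hjj : y j ≠ y (j + 1) := by
    intro h
    have := modEq_small (s := j) (i := 0) (j := 1) (by omega) (by omega) ((hy _ _).1 h)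
    omega
  have hj0 : y j ∈ e := c1 (by rw [hpe]; simp)
  have hj1 : y (j + 1) ∈ e := c1 (by rw [hpe]; simp)
  have hEe : ∀ i < 2 * k - 1, E (j + 1 + i) ≠ e := by
    intro i hi h
    have h1 := (hE (j + 1 + i)).2
    rw [h, hpe, ← hlast] at h1
    have hl2 : y (j + 1) = y (j + 1 + (2 * k - 1) + 1) := by
      rw [hy, show j + 1 + (2 * k - 1) + 1 = j + 1 + 2 * k by omega]
      simp [Nat.ModEq]
    rw [hl2] at h1
    have := modEq_small (by omega) (by omega) (pair_modEq (by omega) hy h1)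
    omega
  have hEh : ∀ i, E i ≠ hh e := fun i h => hdis _ (hE i).1 (h ▸ b2)
  have heh : e ≠ hh e := fun h => hdis _ he (h ▸ b2)
  have hEinj : ∀ i < 2 * k - 1, ∀ i' < 2 * k - 1, E (j + 1 + i) = E (j + 1 + i') → i = i' := by
    intro i hi i' hi' h
    have h1 := (hE (j + 1 + i)).2
    rw [h, (hE (j + 1 + i')).2] at h1
    exact (modEq_small (by omega) (by omega) (pair_modEq (by omega) hy h1)).symm
  have hEm : ∀ i, y i ∈ E i ∧ y (i + 1) ∈ E i := by
    intro i
    have := (hp _ (hE i).1).1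
    rw [(hE i).2] at this
    exact ⟨this (by simp), this (by simp)⟩
  -- the two hyperedges subdividing
  have hAB : ∃ A B : Finset V, A ∈ H ∧ B ∈ H ∧ A ≠ B ∧ (∀ i < 2 * k - 1, E (j + 1 + i) ≠ A) ∧
      (∀ i < 2 * k - 1, E (j + 1 + i) ≠ B) ∧ y j ∈ A ∧ v ∈ A ∧ v ∈ B ∧ y (j + 1) ∈ B := by
    rw [hpe] at c3
    simp only [Finset.mem_insert, Finset.mem_singleton] at c3
    rcases c3 with c3 | c3
    · refine ⟨e, hh e, hH2 _ he, hH1 _ b2, heh, hEe, fun i _ => hEh _, hj0, hv, b3 ?_, b3 ?_⟩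
      · rw [c3]; exact Finset.mem_erase.2 ⟨hno' _, hv⟩
      · rw [c3]; exact Finset.mem_erase.2 ⟨hjj.symm, hj1⟩
    · refine ⟨hh e, e, hH1 _ b2, hH2 _ he, heh.symm, fun i _ => hEh _, hEe, b3 ?_, b3 ?_, hv, hj1⟩
      · rw [c3]; exact Finset.mem_erase.2 ⟨hjj, hj0⟩
      · rw [c3]; exact Finset.mem_erase.2 ⟨hno' _, hv⟩
  obtain ⟨A, B, hA, hB, hABne, hEA, hEB, d1, d2, d3, d4⟩ := hAB
  apply hfree
  apply berge_of_cycle _ (by omega) _ (fun i => if i < 2 * k then y (j + 1 + i) else v)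
    (fun i => if i < 2 * k - 1 then E (j + 1 + i) else if i = 2 * k - 1 then A else B)
  · intro i hi i' hi' h
    split_ifs at h with e1 e2 e2
    · exact modEq_small e1 e2 ((hy _ _).1 h)
    · exact absurd h.symm (hno' _)
    · exact absurd h (hno' _)
    · omega
  · intro i hi i' hi' h
    split_ifs at h with e1 e2 e3 e2 e3 e4 e3 e4
    · exact hEinj _ e1 _ e2 h
    · exact absurd h (hEA _ e1)
    · exact absurd h (hEB _ e1)
    · exact absurd h.symm (hEA _ e3)
    · omega
    · exact absurd h hABne
    · exact absurd h.symm (hEB _ e3)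
    · exact absurd h.symm hABne
    · omega
  · intro i hi
    split_ifs
    · exact hH2 _ (hE _).1
    · exact hA
    · exact hB
  · intro i hi
    rcases lt_trichotomy i (2 * k - 1) with c | c | c
    · rw [if_pos (show i < 2 * k by omega), if_pos c]
      exact (hEm _).1
    · rw [if_pos (show i < 2 * k by omega), if_neg (show ¬ i < 2 * k - 1 by omega), if_pos c, c, hlast]
      exact d1
    · rw [if_neg (show ¬ i < 2 * k by omega), if_neg (show ¬ i < 2 * k - 1 by omega),
        if_neg (show ¬ i = 2 * k - 1 by omega)]
      exact d3
  · intro i hi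
    rcases lt_trichotomy i (2 * k - 1) with c | c | c
    · rw [if_pos (show i + 1 < 2 * k by omega), if_pos c]
      exact (hEm (j + 1 + i)).2
    · rw [if_neg (show ¬ i + 1 < 2 * k by omega), if_neg (show ¬ i < 2 * k - 1 by omega), if_pos c]
      exact d2
    · omega
  · have : ¬ (2 * k + 1 - 1 < 2 * k - 1) := by omega
    have h' : ¬ (2 * k + 1 - 1 = 2 * k - 1) := by omega
    have h'' : 0 < 2 * k := by omega
    simp only [this, h', h'', if_true, if_false]
    exact d4

theorem full_fiber {V : Type*} [DecidableEq V] (q Y : Finset V) (F : Finset (Finset V))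
    (hF : ∀ e ∈ F, q ⊆ e ∧ e ⊆ Y ∧ e.card = 3) (hq : q.card = 2) (hqY : q ⊆ Y)
    (hc : Y.card ≤ F.card + 2) : ∀ v ∈ Y, v ∉ q → insert v q ∈ F := by
  have hsub : F ⊆ (Y \ q).image (fun v => insert v q) := by
    intro e he
    obtain ⟨h1, h2, h3⟩ := hF e he
    have : (e \ q).card = 1 := by rw [Finset.card_sdiff_of_subset h1]; omega
    obtain ⟨v, hv⟩ := Finset.card_eq_one.1 this
    have hv' : v ∈ e \ q := by rw [hv]; simp
    rw [Finset.mem_sdiff] at hv'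
    refine Finset.mem_image.2 ⟨v, Finset.mem_sdiff.2 ⟨h2 hv'.1, hv'.2⟩, ?_⟩
    rw [Finset.insert_eq, ← hv, Finset.sdiff_union_of_subset h1]
  have heq := Finset.eq_of_subset_of_card_le hsub (by
    refine Finset.card_image_le.trans ?_
    rw [Finset.card_sdiff_of_subset hqY]
    omega)
  intro v hv hvq
  rw [heq]
  exact Finset.mem_image.2 ⟨v, Finset.mem_sdiff.2 ⟨hv, hvq⟩, rfl⟩

theorem max_count {n : ℕ} (S : Finset (Fin n)) (x : Fin n) (hx : x ∈ S) :
    (Finset.univ.filter (fun σ : Equiv.Perm (Fin n) => ∀ z ∈ S, σ z ≤ σ x)).card * S.card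
      = n.factorial := by
  have hsame : ∀ y ∈ S, (Finset.univ.filter (fun σ : Equiv.Perm (Fin n) => ∀ z ∈ S, σ z ≤ σ y)).card
      = (Finset.univ.filter (fun σ : Equiv.Perm (Fin n) => ∀ z ∈ S, σ z ≤ σ x)).card := by
    intro y hy
    have hS : ∀ z ∈ S, Equiv.swap x y z ∈ S := by
      intro z hz
      rw [Equiv.swap_apply_def]
      split_ifs <;> assumption
    apply Finset.card_bij' (fun σ _ => σ * Equiv.swap x y) (fun σ _ => σ * Equiv.swap x y)
    · intro σ hσ
      simp only [Finset.mem_filter, Finset.mem_univ, true_and] at hσ ⊢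
      intro z hz
      simpa using hσ _ (hS z hz)
    · intro σ hσ
      simp only [Finset.mem_filter, Finset.mem_univ, true_and] at hσ ⊢
      intro z hz
      simpa using hσ _ (hS z hz)
    · intro σ _
      simp [mul_assoc]
    · intro σ _
      simp [mul_assoc]
  have hdisj : (S : Set (Fin n)).PairwiseDisjoint
      (fun y => Finset.univ.filter (fun σ : Equiv.Perm (Fin n) => ∀ z ∈ S, σ z ≤ σ y)) := by
    intro a ha b hb hab
    rw [Function.onFun, Finset.disjoint_left]
    intro σ h1 h2
    simp only [Finset.mem_filter, Finset.mem_univ, true_and] at h1 h2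
    exact hab (σ.injective (le_antisymm (h2 _ ha) (h1 _ hb)))
  have hcov : S.biUnion (fun y => Finset.univ.filter
      (fun σ : Equiv.Perm (Fin n) => ∀ z ∈ S, σ z ≤ σ y)) = Finset.univ := by
    ext σ
    simp only [Finset.mem_biUnion, Finset.mem_filter, Finset.mem_univ, true_and, iff_true]
    exact Finset.exists_max_image S (fun z => σ z) ⟨x, hx⟩
  have := Finset.card_biUnion hdisj
  rw [hcov, Finset.sum_congr rfl hsame, Finset.sum_const, Finset.card_univ, Fintype.card_perm,
    Fintype.card_fin, smul_eq_mul] at this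
  rw [this, mul_comm]

theorem inc_count {n : ℕ} (S R : Finset (Fin n)) (hRS : R ⊆ S)
    (Inc : Equiv.Perm (Fin n) → Prop) [DecidablePred Inc]
    (h : ∀ x ∈ R, ∀ σ : Equiv.Perm (Fin n), (∀ z ∈ S, σ z ≤ σ x) → Inc σ) :
    R.card * n.factorial ≤ (Finset.univ.filter Inc).card * S.card := by
  have hdisj : (R : Set (Fin n)).PairwiseDisjoint
      (fun y => Finset.univ.filter (fun σ : Equiv.Perm (Fin n) => ∀ z ∈ S, σ z ≤ σ y)) := by
    intro a ha b hb hab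
    rw [Function.onFun, Finset.disjoint_left]
    intro σ h1 h2
    simp only [Finset.mem_filter, Finset.mem_univ, true_and] at h1 h2
    exact hab (σ.injective (le_antisymm (h2 _ (hRS ha)) (h1 _ (hRS hb))))
  have hsub : R.biUnion (fun y => Finset.univ.filter
      (fun σ : Equiv.Perm (Fin n) => ∀ z ∈ S, σ z ≤ σ y)) ⊆ Finset.univ.filter Inc := by
    intro σ hσ
    simp only [Finset.mem_biUnion, Finset.mem_filter, Finset.mem_univ, true_and] at hσ ⊢
    obtain ⟨x, hx, hσ⟩ := hσ
    exact h x hx σ hσ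
  calc R.card * n.factorial = ∑ x ∈ R, (Finset.univ.filter
        (fun σ : Equiv.Perm (Fin n) => ∀ z ∈ S, σ z ≤ σ x)).card * S.card := by
        rw [Finset.sum_congr rfl (fun x hx => max_count S x (hRS hx)), Finset.sum_const,
          smul_eq_mul]
    _ = (R.biUnion (fun y => Finset.univ.filter
      (fun σ : Equiv.Perm (Fin n) => ∀ z ∈ S, σ z ≤ σ y))).card * S.card := by
        rw [Finset.card_biUnion hdisj, Finset.sum_mul]
    _ ≤ _ := Nat.mul_le_mul_right _ (Finset.card_le_card hsub)

/-- The pair `q` is kept with respect to the ordering `σ`. -/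
def Inc {n : ℕ} (k : ℕ) (H2 : Finset (Finset (Fin n))) (p : Finset (Fin n) → Finset (Fin n))
    (σ : Equiv.Perm (Fin n)) (q : Finset (Fin n)) : Prop :=
  2 * k - 2 ≤ (H2.filter (fun e => p e = q)).card ∨
  (3 ≤ k ∧ ∃ e ∈ H2, p e = q ∧ ∃ v ∈ e, ∀ u ∈ q, σ u < σ v) ∨
  (k = 2 ∧ ∃ e ∈ H2, p e = q ∧ ∃ u ∈ q, ∀ v ∈ e, σ v ≤ σ u)

theorem inc_card {n k : ℕ} (hk : 2 ≤ k) (H2 : Finset (Finset (Fin n)))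
    (p : Finset (Fin n) → Finset (Fin n)) (q : Finset (Fin n))
    (h3 : ∀ e ∈ H2, e.card = 3) (hp : ∀ e ∈ H2, p e ⊆ e ∧ (p e).card = 2)
    (hfib : (H2.filter (fun e => p e = q)).card ≤ 2 * k - 2) :
    3 * (H2.filter (fun e => p e = q)).card * n.factorial ≤
      8 * (k - 1) * (Finset.univ.filter (fun σ => Inc k H2 p σ q)).card := by
  obtain ⟨l, rfl⟩ : ∃ l, k = l + 2 := ⟨k - 2, by omega⟩
  set F := H2.filter (fun e => p e = q) with hF
  rcases F.eq_empty_or_nonempty with h0 | ⟨e0, he0⟩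
  · rw [h0]; simp
  have hFm : ∀ e ∈ F, e ∈ H2 ∧ p e = q := fun e he => Finset.mem_filter.1 he
  have hq : q.card = 2 := by rw [← (hFm e0 he0).2]; exact (hp e0 (hFm e0 he0).1).2
  have hqe : ∀ e ∈ F, q ⊆ e := by
    intro e he
    have := (hp e (hFm e he).1).1
    rwa [(hFm e he).2] at this
  by_cases hfull : 2 * (l + 2) - 2 ≤ F.card
  · have : (Finset.univ.filter (fun σ => Inc (l + 2) H2 p σ q)) = Finset.univ := by
      apply Finset.filter_true_of_mem
      intro σ _
      exact Or.inl hfull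
    rw [this, Finset.card_univ, Fintype.card_perm, Fintype.card_fin]
    apply Nat.mul_le_mul_right
    omega
  have hF1 : 1 ≤ F.card := Finset.card_pos.2 ⟨e0, he0⟩
  rcases Nat.eq_zero_or_pos l with rfl | hl
  · have := inc_count e0 q (hqe e0 he0) (fun σ => Inc (0 + 2) H2 p σ q) (by
      intro x hx σ hσ
      exact Or.inr (Or.inr ⟨by omega, e0, (hFm e0 he0).1, (hFm e0 he0).2, x, hx, hσ⟩))
    rw [h3 e0 (hFm e0 he0).1, hq] at this
    have h1 : F.card = 1 := by omega
    rw [h1]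
    omega
  · have ht : ∀ e : Finset (Fin n), ∃ v, e ∈ F → v ∈ e ∧ v ∉ q ∧ e = insert v q := by
      intro e
      by_cases he : e ∈ F
      · have : (e \ q).card = 1 := by
          rw [Finset.card_sdiff_of_subset (hqe e he), hq, h3 e (hFm e he).1]
        obtain ⟨v, hv⟩ := Finset.card_eq_one.1 this
        have hv' : v ∈ e \ q := by rw [hv]; simp
        rw [Finset.mem_sdiff] at hv'
        refine ⟨v, fun _ => ⟨hv'.1, hv'.2, ?_⟩⟩
        rw [Finset.insert_eq, ← hv, Finset.sdiff_union_of_subset (hqe e he)]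
      · have hne : q.Nonempty := Finset.card_pos.1 (by omega)
        exact ⟨hne.choose, fun h => absurd h he⟩
    choose t ht using ht
    have hTc : (F.image t).card = F.card := by
      apply Finset.card_image_of_injOn
      intro a ha b hb hab
      simp only [Finset.mem_coe] at ha hb
      rw [(ht a ha).2.2, (ht b hb).2.2, hab]
    have hdis : Disjoint q (F.image t) := by
      rw [Finset.disjoint_right]
      intro v hv
      obtain ⟨e, he, rfl⟩ := Finset.mem_image.1 hv
      exact (ht e he).2.1
    have := inc_count (q ∪ F.image t) (F.image t) Finset.subset_union_right
      (fun σ => Inc (l + 2) H2 p σ q) (by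
        intro x hx σ hσ
        refine Or.inr (Or.inl ⟨by omega, ?_⟩)
        obtain ⟨e, he, rfl⟩ := Finset.mem_image.1 hx
        refine ⟨e, (hFm e he).1, (hFm e he).2, t e, (ht e he).1, fun u hu => ?_⟩
        refine lt_of_le_of_ne (hσ u (Finset.mem_union_left _ hu)) fun h => ?_
        exact (ht e he).2.1 (σ.injective h ▸ hu))
    rw [Finset.card_union_of_disjoint hdis, hTc, hq] at this
    calc 3 * F.card * n.factorial = 3 * (F.card * n.factorial) := by ring
      _ ≤ 3 * ((Finset.univ.filter (fun σ => Inc (l + 2) H2 p σ q)).card * (2 + F.card)) :=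
        Nat.mul_le_mul_left _ this
      _ = (3 * (2 + F.card)) * (Finset.univ.filter (fun σ => Inc (l + 2) H2 p σ q)).card := by ring
      _ ≤ _ := Nat.mul_le_mul_right _ (by omega)



/-- The graph of kept pairs. -/
def keptGraph {n : ℕ} (k : ℕ) (H2 : Finset (Finset (Fin n)))
    (p : Finset (Fin n) → Finset (Fin n)) (σ : Equiv.Perm (Fin n)) : SimpleGraph (Fin n) where
  Adj a b := a ≠ b ∧ Inc k H2 p σ {a, b} ∧ ∃ e ∈ H2, p e = {a, b}
  symm := ⟨by
    intro a b h
    rw [Finset.pair_comm b a]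
    exact ⟨h.1.symm, h.2⟩⟩
  loopless := ⟨fun a h => h.1 rfl⟩

theorem kept_free {n : ℕ} {H H1 H2 : Finset (Finset (Fin n))}
    {w : Finset (Fin n) → Fin n}
    {hh p : Finset (Fin n) → Finset (Fin n)} {k : ℕ} (hk : 2 ≤ k)
    (hH1 : ∀ e ∈ H1, e ∈ H)
    (hfree : ¬ HasBergeCopy (SimpleGraph.cycleGraph (2 * k + 1)) H)
    (hH2 : ∀ e ∈ H2, e ∈ H) (hdis : ∀ e ∈ H2, e ∉ H1)
    (h3 : ∀ e ∈ H2, e.card = 3)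
    (hw : ∀ e ∈ H2, w e ∈ e ∧ hh e ∈ H1 ∧ e.erase (w e) ⊆ hh e)
    (hp : ∀ e ∈ H2, p e ⊆ e ∧ (p e).card = 2 ∧ w e ∈ p e) (σ : Equiv.Perm (Fin n)) :
    ¬ HasCopy (SimpleGraph.cycleGraph (2 * k)) (keptGraph k H2 p σ) := by
  intro hcopy
  obtain ⟨y, hy, hadj⟩ := cycle_seq (by omega) hcopy
  have hE : ∀ i, ∃ e, e ∈ H2 ∧ p e = {y i, y (i + 1)} := fun i => by
    obtain ⟨e, he⟩ := (hadj i).2.2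
    exact ⟨e, he⟩
  choose E hE using hE
  have third := third_in_cycle hk hH1 hfree hH2 hdis hw hp hy hE
  set Y := (Finset.range (2 * k)).image y with hY
  have hYm : ∀ i, y i ∈ Y := by
    intro i
    refine Finset.mem_image.2 ⟨i % (2 * k), by simpa using Nat.mod_lt _ (by omega), ?_⟩
    exact (hy _ _).2 (Nat.mod_modEq _ _)
  have hYc : Y.card ≤ 2 * k := by
    simpa using Finset.card_image_le (s := Finset.range (2 * k)) (f := y)
  have hne : ∀ s i j, i < 2 * k → j < 2 * k → i ≠ j → y (s + i) ≠ y (s + j) := by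
    intro s i j hi hj hij h
    exact hij (modEq_small hi hj ((hy _ _).1 h))
  -- a full pair has all its triples inside the cycle
  have full : ∀ i, 2 * k - 2 ≤ (H2.filter (fun e => p e = {y i, y (i + 1)})).card →
      ∀ v ∈ Y, v ∉ ({y i, y (i + 1)} : Finset (Fin n)) →
      insert v {y i, y (i + 1)} ∈ H2 ∧ p (insert v {y i, y (i + 1)}) = {y i, y (i + 1)} := by
    intro i hi v hv hvq
    have := full_fiber {y i, y (i + 1)} Y (H2.filter (fun e => p e = {y i, y (i + 1)})) ?_
      (Finset.card_pair (hadj i).1) ?_ (by omega) v hv hvq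
    · exact Finset.mem_filter.1 this
    · intro e he
      obtain ⟨he1, he2⟩ := Finset.mem_filter.1 he
      refine ⟨he2 ▸ (hp e he1).1, ?_, h3 e he1⟩
      intro v hv
      obtain ⟨j, -, rfl⟩ := third i e he1 he2 v hv
      exact hYm j
    · simp only [Finset.insert_subset_iff, Finset.singleton_subset_iff]
      exact ⟨hYm _, hYm _⟩
  obtain ⟨m, -, hm⟩ := Finset.exists_max_image (Finset.range (2 * k)) (fun i => σ (y i))
    ⟨0, by simp; omega⟩
  have hmax : ∀ i, σ (y i) ≤ σ (y m) := by
    intro i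
    have := hm (i % (2 * k)) (by simpa using Nat.mod_lt _ (by omega))
    rwa [(hy _ _).2 (Nat.mod_modEq i (2 * k))] at this
  rcases Nat.lt_or_ge 2 k with hk3 | hk2
  · -- k ≥ 3
    have hs : y (m + (2 * k - 1) + 1) = y m := by
      rw [hy, show m + (2 * k - 1) + 1 = m + 2 * k by omega]
      simp [Nat.ModEq]
    have hs2 : y (m + (2 * k - 1) + 2) = y (m + 1) := by
      rw [hy, show m + (2 * k - 1) + 2 = m + 1 + 2 * k by omega]
      simp [Nat.ModEq]
    set s := m + (2 * k - 1) with hsdef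
    rw [← hs] at hmax
    have isfull : ∀ i, y (s + 1) ∈ ({y i, y (i + 1)} : Finset (Fin n)) →
        2 * k - 2 ≤ (H2.filter (fun e => p e = {y i, y (i + 1)})).card := by
      intro i hi
      rcases (hadj i).2.1 with h | ⟨-, e, he, hpe, v, hv, h⟩ | ⟨h, -⟩
      · exact h
      · exfalso
        obtain ⟨j, -, rfl⟩ := third i e he hpe v hv
        exact absurd (hmax j) (not_le.2 (h _ hi))
      · omega
    have n1 := hne s 0 1 (by omega) (by omega) (by omega)
    have n2 := hne s 0 2 (by omega) (by omega) (by omega)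
    have n3 := hne s 1 2 (by omega) (by omega) (by omega)
    rw [Nat.add_zero] at n1 n2
    have f1 := full s (isfull s (by simp)) (y (s + 2)) (hYm _) (by
      simp only [Finset.mem_insert, Finset.mem_singleton, not_or]
      exact ⟨n2.symm, n3.symm⟩)
    have f2 := full (s + 1) (isfull (s + 1) (by simp)) (y s) (hYm _) (by
      simp only [Finset.mem_insert, Finset.mem_singleton, not_or]
      exact ⟨n1, n2⟩)
    have heq : (insert (y (s + 2)) {y s, y (s + 1)} : Finset (Fin n))
        = insert (y s) {y (s + 1), y (s + 1 + 1)} := by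
      ext a
      simp only [Finset.mem_insert, Finset.mem_singleton]
      tauto
    have h2 := f2.2
    rw [← heq, f1.2] at h2
    have : y s ∈ ({y (s + 1), y (s + 1 + 1)} : Finset (Fin n)) := by rw [← h2]; simp
    simp only [Finset.mem_insert, Finset.mem_singleton] at this
    rcases this with h | h
    · exact n1 h
    · exact n2 h
  · have hk' : k = 2 := by omega
    subst hk'
    have n01 := hne m 0 1 (by omega) (by omega) (by omega)
    have n02 := hne m 0 2 (by omega) (by omega) (by omega)
    have n03 := hne m 0 3 (by omega) (by omega) (by omega)
    have n12 := hne m 1 2 (by omega) (by omega) (by omega)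
    have n13 := hne m 1 3 (by omega) (by omega) (by omega)
    have n23 := hne m 2 3 (by omega) (by omega) (by omega)
    rw [Nat.add_zero] at n01 n02 n03
    have hall : ∀ i, y i = y m ∨ y i = y (m + 1) ∨ y i = y (m + 2) ∨ y i = y (m + 3) := by
      intro i
      have : ∀ j, (i + (m * 3)) % 4 = j → i ≡ m + j [MOD 4] := by
        intro j hj
        have : i % 4 = (m + j) % 4 := by omega
        exact this
      have hlt := Nat.mod_lt (i + m * 3) (show 0 < 4 by omega)
      generalize hr : (i + m * 3) % 4 = r at hlt this
      have h1 := (hy i (m + r)).2 (this r rfl)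
      interval_cases r <;> simp [h1]
    -- the triple avoiding the maximum is assigned to each pair avoiding the maximum
    have key : ∀ i v, y m ∉ ({y i, y (i + 1)} : Finset (Fin n)) → v ∈ Y → 
        v ∉ ({y i, y (i + 1)} : Finset (Fin n)) → 
        (∀ j, y j = y m ∨ y j = v ∨ y j ∈ ({y i, y (i + 1)} : Finset (Fin n))) →
        p (insert v {y i, y (i + 1)}) = {y i, y (i + 1)} := by
      intro i v hmi hvY hvi hcov
      rcases (hadj i).2.1 with h | ⟨h, -⟩ | ⟨-, e, he, hpe, u, hu, h⟩
      · exact (full i h v hvY hvi).2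
      · omega
      · have hsub : e ⊆ insert v {y i, y (i + 1)} := by
          intro z hz
          obtain ⟨j, -, rfl⟩ := third i e he hpe z hz
          rcases hcov j with hj | hj | hj
          · exfalso
            have h1 := h _ hz
            rw [hj] at h1
            have hu' : u = y i ∨ u = y (i + 1) := by simpa using hu
            have h2 : σ u ≤ σ (y m) := by
              rcases hu' with rfl | rfl <;> exact hmax _
            have := σ.injective (le_antisymm h1 h2)
            rw [this] at hmi
            exact hmi hu
          · rw [hj]; simp
          · exact Finset.mem_insert_of_mem hj
        have := Finset.eq_of_subset_of_card_le hsub (by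
          rw [h3 e he, Finset.card_insert_of_notMem hvi, Finset.card_pair (hadj i).1])
        rw [← this]
        exact hpe
    have k1 := key (m + 1) (y (m + 3)) (by
        simp only [Finset.mem_insert, Finset.mem_singleton, not_or]
        exact ⟨n01, n02⟩) (hYm _) (by
        simp only [Finset.mem_insert, Finset.mem_singleton, not_or]
        exact ⟨n13.symm, n23.symm⟩) (by
        intro j
        simp only [Finset.mem_insert, Finset.mem_singleton]
        have := hall j
        tauto)
    have k2 := key (m + 2) (y (m + 1)) (by
        simp only [Finset.mem_insert, Finset.mem_singleton, not_or]
        exact ⟨n02, n03⟩) (hYm _) (by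
        simp only [Finset.mem_insert, Finset.mem_singleton, not_or]
        exact ⟨n12, n13⟩) (by
        intro j
        simp only [Finset.mem_insert, Finset.mem_singleton]
        have := hall j
        tauto)
    have heq : (insert (y (m + 3)) {y (m + 1), y (m + 1 + 1)} : Finset (Fin n))
        = insert (y (m + 1)) {y (m + 2), y (m + 2 + 1)} := by
      ext a
      simp only [Finset.mem_insert, Finset.mem_singleton]
      tauto
    rw [heq, k2] at k1
    have : y (m + 3) ∈ ({y (m + 1), y (m + 1 + 1)} : Finset (Fin n)) := by rw [← k1]; simp
    simp only [Finset.mem_insert, Finset.mem_singleton] at this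
    rcases this with h | h
    · exact n13 h.symm
    · exact n23 h.symm

theorem kept_edges {n k : ℕ} (H2 : Finset (Finset (Fin n)))
    (p : Finset (Fin n) → Finset (Fin n)) (σ : Equiv.Perm (Fin n))
    (hp : ∀ e ∈ H2, (p e).card = 2) :
    ((H2.image p).filter (fun q => Inc k H2 p σ q)).card ≤ edgeCount (keptGraph k H2 p σ) := by
  unfold edgeCount
  rw [← Set.ncard_coe_finset]
  refine le_trans (Set.ncard_le_ncard ?_ (Set.toFinite _))
    (Set.ncard_image_le (f := fun s : Sym2 (Fin n) => s.toFinset) (Set.toFinite _))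
  intro q hq
  simp only [Finset.mem_coe, Finset.mem_filter, Finset.mem_image] at hq
  obtain ⟨⟨e, he, rfl⟩, hinc⟩ := hq
  obtain ⟨a, b, hab, hpe⟩ := Finset.card_eq_two.1 (hp e he)
  refine ⟨s(a, b), ?_, ?_⟩
  · rw [SimpleGraph.mem_edgeSet]
    exact ⟨hab, hpe ▸ hinc, e, he, hpe⟩
  · rw [hpe]
    ext z
    simp

theorem turan_ge {n k : ℕ} (G : SimpleGraph (Fin n))
    (h : ¬ HasCopy (SimpleGraph.cycleGraph k) G) :
    edgeCount G ≤ exTuran n (SimpleGraph.cycleGraph k) := by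
  apply le_csSup
  · apply Set.Finite.bddAbove
    apply (Set.finite_range (fun G : SimpleGraph (Fin n) => edgeCount G)).subset
    rintro m ⟨G, -, rfl⟩
    exact ⟨G, rfl⟩
  · exact ⟨G, h, rfl⟩

theorem second_bound {n : ℕ} {H H1 H2 : Finset (Finset (Fin n))}
    {w : Finset (Fin n) → Fin n}
    {hh : Finset (Fin n) → Finset (Fin n)} {k : ℕ} (hk : 2 ≤ k)
    (hH1 : ∀ e ∈ H1, e ∈ H)
    (hfree : ¬ HasBergeCopy (SimpleGraph.cycleGraph (2 * k + 1)) H)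
    (hH2 : ∀ e ∈ H2, e ∈ H) (hdis : ∀ e ∈ H2, e ∉ H1)
    (h3 : ∀ e ∈ H2, e.card = 3)
    (hw : ∀ e ∈ H2, w e ∈ e ∧ hh e ∈ H1 ∧ e.erase (w e) ⊆ hh e) :
    3 * H2.card ≤ 8 * (k - 1) * exTuran n (SimpleGraph.cycleGraph (2 * k)) := by
  obtain ⟨p, hp, hfib⟩ := exists_assign hk hH1 hfree H2 hH2 hdis h3 hw
  set X := exTuran n (SimpleGraph.cycleGraph (2 * k)) with hX
  have hσ : ∀ σ : Equiv.Perm (Fin n),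
      ((H2.image p).filter (fun q => Inc k H2 p σ q)).card ≤ X := fun σ =>
    (kept_edges H2 p σ (fun e he => (hp e he).2.1)).trans
      (turan_ge _ (kept_free hk hH1 hfree hH2 hdis h3 hw hp σ))
  have hdouble : ∑ σ : Equiv.Perm (Fin n), ((H2.image p).filter (fun q => Inc k H2 p σ q)).card
      = ∑ q ∈ H2.image p, (Finset.univ.filter (fun σ => Inc k H2 p σ q)).card := by
    simp only [Finset.card_filter]
    exact Finset.sum_comm
  have hsum : ∑ σ : Equiv.Perm (Fin n), ((H2.image p).filter (fun q => Inc k H2 p σ q)).card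
      ≤ n.factorial * X := by
    refine (Finset.sum_le_sum (fun σ _ => hσ σ)).trans ?_
    rw [Finset.sum_const, Finset.card_univ, Fintype.card_perm, Fintype.card_fin, smul_eq_mul]
  have hH2c : H2.card = ∑ q ∈ H2.image p, (H2.filter (fun e => p e = q)).card :=
    Finset.card_eq_sum_card_image p H2
  have hmain : 3 * H2.card * n.factorial ≤ 8 * (k - 1) * (n.factorial * X) := by
    refine le_trans ?_ (Nat.mul_le_mul_left _ hsum)
    rw [hdouble, hH2c, Finset.mul_sum, Finset.sum_mul, Finset.mul_sum]
    exact Finset.sum_le_sum (fun q _ =>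
      inc_card hk H2 p q h3 (fun e he => ⟨(hp e he).1, (hp e he).2.1⟩) (hfib q))
  have hpos := n.factorial_pos
  apply Nat.le_of_mul_le_mul_right _ hpos
  refine hmain.trans (le_of_eq ?_)
  ring

theorem main_bound {n k : ℕ} (hk : 2 ≤ k) (H : Finset (Finset (Fin n)))
    (h3 : ∀ e ∈ H, e.card = 3)
    (hfree : ¬ HasBergeCopy (SimpleGraph.cycleGraph (2 * k + 1)) H) :
    3 * H.card ≤ 8 * (k - 1) * exTuran n (SimpleGraph.cycleGraph (2 * k)) +
      3 * exBergeLin 3 n (SimpleGraph.cycleGraph (2 * k + 1)) := by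
  obtain ⟨H1, hH1, hmax⟩ := Finset.exists_max_image
    (H.powerset.filter (fun A => IsLinear A)) Finset.card ⟨∅, Finset.mem_filter.2 ⟨Finset.empty_mem_powerset _, by intro a ha; simp at ha⟩⟩
  simp only [Finset.mem_filter, Finset.mem_powerset] at hH1 hmax
  obtain ⟨hsub, hlin⟩ := hH1
  have hext : ∀ e ∈ H \ H1, ∃ h ∈ H1, 2 ≤ (e ∩ h).card := by
    intro e he
    rw [Finset.mem_sdiff] at he
    by_contra hcon
    push Not at hcon
    have hl : IsLinear (insert e H1) := by
      intro a ha b hb hab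
      rw [Finset.mem_insert] at ha hb
      rcases ha with rfl | ha <;> rcases hb with rfl | hb
      · exact absurd rfl hab
      · have := hcon b hb
        omega
      · have := hcon a ha
        rw [Finset.inter_comm]
        omega
      · exact hlin a ha b hb hab
    have := hmax (insert e H1) ⟨Finset.insert_subset he.1 hsub, hl⟩
    rw [Finset.card_insert_of_notMem he.2] at this
    omega
  have hext2 : ∀ e : Finset (Fin n), ∃ h : Finset (Fin n), ∃ v : Option (Fin n), e ∈ H \ H1 →
      ∃ v', v = some v' ∧ v' ∈ e ∧ h ∈ H1 ∧ e.erase v' ⊆ h := by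
    intro e
    by_cases he : e ∈ H \ H1
    · obtain ⟨h, hh, hc⟩ := hext e he
      have he' := Finset.mem_sdiff.1 he
      have hlt : (e \ h).card ≤ 1 := by
        have := Finset.card_sdiff_add_card_inter e h
        rw [h3 e he'.1] at this
        omega
      have hne : ¬ e ⊆ h ∨ e ⊆ h := (em _).symm
      rcases hne with hne | hne
      · obtain ⟨v, hv, hvh⟩ := Finset.not_subset.1 hne
        refine ⟨h, some v, fun _ => ⟨v, rfl, hv, hh, ?_⟩⟩
        intro z hz
        by_contra hzh
        rw [Finset.mem_erase] at hz
        exact hz.1 (Finset.card_le_one.1 hlt z (Finset.mem_sdiff.2 ⟨hz.2, hzh⟩) v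
          (Finset.mem_sdiff.2 ⟨hv, hvh⟩))
      · have hne : e.Nonempty := Finset.card_pos.1 (by rw [h3 e he'.1]; omega)
        obtain ⟨v, hv⟩ := hne
        exact ⟨h, some v, fun _ => ⟨v, rfl, hv, hh, (Finset.erase_subset _ _).trans hne⟩⟩
    · exact ⟨∅, none, fun h => absurd h he⟩
  have hlinle : H1.card ≤ exBergeLin 3 n (SimpleGraph.cycleGraph (2 * k + 1)) := by
    apply le_csSup
    · apply Set.Finite.bddAbove
      apply (Set.finite_range (fun A : Finset (Finset (Fin n)) => A.card)).subset
      rintro m ⟨G, -, -, -, rfl⟩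
      exact ⟨G, rfl⟩
    · refine ⟨H1, fun e he => h3 e (hsub he), ?_, ?_, rfl⟩
      · convert hlin
      · rintro ⟨φ, f, hf, h⟩
        exact hfree ⟨φ, f, hf, fun e => ⟨hsub (h e).1, (h e).2⟩⟩
  have hcard : (H \ H1).card + H1.card = H.card := Finset.card_sdiff_add_card_eq_card hsub
  rcases (H \ H1).eq_empty_or_nonempty with h0 | ⟨e0, he0⟩
  · rw [h0] at hcard
    simp at hcard
    rw [← hcard]
    nlinarith
  choose hh v hv using hext2
  obtain ⟨v0, -⟩ := hv e0 he0
  have := second_bound (w := fun e => (v e).getD v0) (hh := hh) hk (fun e he => hsub he) hfree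
    (H2 := H \ H1) (fun e he => (Finset.mem_sdiff.1 he).1) (fun e he => (Finset.mem_sdiff.1 he).2)
    (fun e he => h3 e (Finset.mem_sdiff.1 he).1) (by
      intro e he
      obtain ⟨v', hv1, hv2⟩ := hv e he
      simp only [hv1, Option.getD_some]
      exact hv2)
  omega

/-- For `k > 1`,
`ex_3(n, Berge-C_{2k+1}) ≤ ((8k-8)/3) · ex(n, C_{2k}) + ex_3^lin(n, Berge-C_{2k+1})`. -/
theorem berge_odd_cycle_weak {k : ℕ} (hk : 1 < k) (n : ℕ) :
    (exBerge 3 n (SimpleGraph.cycleGraph (2 * k + 1)) : ℝ) ≤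
      ((8 * (k : ℝ) - 8) / 3) * exTuran n (SimpleGraph.cycleGraph (2 * k)) +
        exBergeLin 3 n (SimpleGraph.cycleGraph (2 * k + 1)) := by
  have key : 3 * exBerge 3 n (SimpleGraph.cycleGraph (2 * k + 1)) ≤
      8 * (k - 1) * exTuran n (SimpleGraph.cycleGraph (2 * k)) +
        3 * exBergeLin 3 n (SimpleGraph.cycleGraph (2 * k + 1)) := by
    rcases Set.eq_empty_or_nonempty {m | ∃ H : Finset (Finset (Fin n)), (∀ e ∈ H, e.card = 3) ∧
      ¬ HasBergeCopy (SimpleGraph.cycleGraph (2 * k + 1)) H ∧ H.card = m} with h | h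
    · have : exBerge 3 n (SimpleGraph.cycleGraph (2 * k + 1)) = 0 := by
        unfold exBerge
        rw [h]
        simp
      rw [this]
      exact Nat.zero_le _
    · have hb : BddAbove {m | ∃ H : Finset (Finset (Fin n)), (∀ e ∈ H, e.card = 3) ∧
          ¬ HasBergeCopy (SimpleGraph.cycleGraph (2 * k + 1)) H ∧ H.card = m} := by
        apply Set.Finite.bddAbove
        apply (Set.finite_range (fun A : Finset (Finset (Fin n)) => A.card)).subset
        rintro m ⟨G, -, -, rfl⟩
        exact ⟨G, rfl⟩
      obtain ⟨H, h3, hfree, hc⟩ := Nat.sSup_mem h hb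
      have := main_bound hk H h3 hfree
      rw [hc] at this
      exact this
  obtain ⟨l, rfl⟩ : ∃ l, k = l + 1 := ⟨k - 1, by omega⟩
  rw [Nat.add_sub_cancel] at key
  have key' : (3 * exBerge 3 n (SimpleGraph.cycleGraph (2 * (l + 1) + 1)) : ℝ) ≤
      8 * l * exTuran n (SimpleGraph.cycleGraph (2 * (l + 1))) +
        3 * exBergeLin 3 n (SimpleGraph.cycleGraph (2 * (l + 1) + 1)) := by
    exact_mod_cast key
  push_cast
  linarith
end
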